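/- Under the Algorithm 1 setup with stepsizes α_t = 1/t^c, β_t = 1/t^κ, γ_t = 1/t^{1−κ} for constants c, κ ∈ (0,1), for any T ∈ ℕ₊ the sequence x_T generated by Algorithm 1 satisfies Reg(x_T, x*_T) ≤ C₁ T^{max{1−c, c, κ}} + 2K T^c V_Φ(x*_T), where x*_T is an optimal sequence, V_Φ(x*_T) = Σ_{t=1}^{T−1} Σ_{i=1}^n ‖x*_{i,t+1} − Φ_{i,t+1}(x*_{i,t})‖, C₁ = C_{1,1}/κ + C_{1,2}/(1−c) + 2n·d(X)·K, C_{1,1} = 3n²τB₁F/(1−λ) + nB₁²/2, C_{1,2} = 4nG²/σ̲, τ = (1 − w/(2n²))^{−2}, λ = (1 − w/(2n²))^{1/ι}, and B₁ = 2F + G·d(X). -/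

import Mathlib

open scoped RealInnerProductSpace

noncomputable section

/-- Bregman divergence generated by `ψ` with gradient map `ψ'`. -/
def breg {d : ℕ} (ψ : EuclideanSpace ℝ (Fin d) → ℝ)
    (ψ' : EuclideanSpace ℝ (Fin d) → EuclideanSpace ℝ (Fin d))
    (x y : EuclideanSpace ℝ (Fin d)) : ℝ :=
  ψ x - ψ y - ⟪ψ' y, x - y⟫

/-- Componentwise positive part `[v]₊`. -/
def posPart {d : ℕ} (v : EuclideanSpace ℝ (Fin d)) : EuclideanSpace ℝ (Fin d) :=
  (WithLp.equiv 2 (Fin d → ℝ)).symm fun j => max (v j) 0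

/-- Build a Euclidean vector from a coordinate function. -/
def vecOf {d : ℕ} (v : Fin d → ℝ) : EuclideanSpace ℝ (Fin d) :=
  (WithLp.equiv 2 (Fin d → ℝ)).symm v

/-- Stack a family of per-agent vectors into the Euclidean product space. -/
def stack {n : ℕ} {p : Fin n → ℕ} (y : ∀ i, EuclideanSpace ℝ (Fin (p i))) :
    PiLp 2 (fun i => EuclideanSpace ℝ (Fin (p i))) :=
  (WithLp.equiv 2 (∀ i, EuclideanSpace ℝ (Fin (p i)))).symm y

/-- The setup and iterates of Algorithm 1 (distributed online primal-dual
dynamic mirror descent) of the paper. -/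
structure Alg (n m : ℕ) (p : Fin n → ℕ) where
  hn : 0 < n
  hm : 0 < m
  X : ∀ i : Fin n, Set (EuclideanSpace ℝ (Fin (p i)))
  hXconvex : ∀ i, Convex ℝ (X i)
  hXcompact : ∀ i, IsCompact (X i)
  hXnonempty : ∀ i, (X i).Nonempty
  dX : ℝ
  hdX : 0 < dX
  hdiam : ∀ u v : PiLp 2 (fun i => EuclideanSpace ℝ (Fin (p i))),
    (∀ i, u i ∈ X i) → (∀ i, v i ∈ X i) → ‖u - v‖ ≤ dX
  f : ℕ → ∀ i : Fin n, EuclideanSpace ℝ (Fin (p i)) → ℝ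
  r : ℕ → ∀ i : Fin n, EuclideanSpace ℝ (Fin (p i)) → ℝ
  g : ℕ → ∀ i : Fin n, EuclideanSpace ℝ (Fin (p i)) → EuclideanSpace ℝ (Fin m)
  hf0 : ∀ i z, f 0 i z = 0
  hr0 : ∀ i z, r 0 i z = 0
  hg0 : ∀ i z, g 0 i z = 0
  hfconvex : ∀ t i, ConvexOn ℝ (X i) (f t i)
  hrconvex : ∀ t i, ConvexOn ℝ (X i) (r t i)
  hgconvex : ∀ t i (j : Fin m), ConvexOn ℝ (X i) (fun z => g t i z j)
  F : ℝ
  hF : 0 < F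
  G : ℝ
  hG : 0 < G
  hfbound : ∀ t i, ∀ z ∈ X i, |f t i z| ≤ F
  hrbound : ∀ t i, ∀ z ∈ X i, |r t i z| ≤ F
  hgbound : ∀ t i, ∀ z ∈ X i, ‖g t i z‖ ≤ F
  Gf : ℕ → ∀ i : Fin n, EuclideanSpace ℝ (Fin (p i)) → EuclideanSpace ℝ (Fin (p i))
  Gr : ℕ → ∀ i : Fin n, EuclideanSpace ℝ (Fin (p i)) → EuclideanSpace ℝ (Fin (p i))
  Gg : ℕ → ∀ i : Fin n, EuclideanSpace ℝ (Fin (p i)) → Fin m → EuclideanSpace ℝ (Fin (p i))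
  hGfsub : ∀ t i, ∀ z ∈ X i, ∀ u ∈ X i, f t i z + ⟪Gf t i z, u - z⟫ ≤ f t i u
  hGrsub : ∀ t i, ∀ z ∈ X i, ∀ u ∈ X i, r t i z + ⟪Gr t i z, u - z⟫ ≤ r t i u
  hGgsub : ∀ t i, ∀ z ∈ X i, ∀ (j : Fin m), ∀ u ∈ X i,
    g t i z j + ⟪Gg t i z j, u - z⟫ ≤ g t i u j
  hGfbound : ∀ t i, ∀ z ∈ X i, ‖Gf t i z‖ ≤ G
  hGrbound : ∀ t i, ∀ z ∈ X i, ‖Gr t i z‖ ≤ G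
  hGgbound : ∀ t i, ∀ z ∈ X i, ∀ v, ‖vecOf (fun j => ⟪Gg t i z j, v⟫)‖ ≤ G * ‖v‖
  W : ℕ → Matrix (Fin n) (Fin n) ℝ
  hWnonneg : ∀ t i j, 0 ≤ W t i j
  hWrow : ∀ t i, ∑ j, W t i j = 1
  hWcol : ∀ t j, ∑ i, W t i j = 1
  w : ℝ
  hw0 : 0 < w
  hw1 : w < 1
  hWdiag : ∀ t i, w ≤ W t i i
  hWpos : ∀ t i j, 0 < W t i j → w ≤ W t i j
  iota : ℕ
  hiota : 0 < iota
  hconn : ∀ (t : ℕ) (c d : Fin n),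
    Relation.ReflTransGen (fun u v : Fin n => ∃ l < iota, 0 < W (t + l) v u) c d
  ψ : ∀ i : Fin n, EuclideanSpace ℝ (Fin (p i)) → ℝ
  ψ' : ∀ i : Fin n, EuclideanSpace ℝ (Fin (p i)) → EuclideanSpace ℝ (Fin (p i))
  hψgrad : ∀ i z, HasGradientAt (ψ i) (ψ' i z) z
  σ : Fin n → ℝ
  hσ : ∀ i, 0 < σ i
  hψstrong : ∀ i, ∀ z ∈ X i, ∀ u ∈ X i,
    ψ i u + ⟪ψ' i u, z - u⟫ + σ i / 2 * ‖z - u‖ ^ 2 ≤ ψ i z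
  K : ℝ
  hK : 0 < K
  hbregLip : ∀ i, ∀ z₁ ∈ X i, ∀ z₂ ∈ X i, ∀ u ∈ X i,
    |breg (ψ i) (ψ' i) z₁ u - breg (ψ i) (ψ' i) z₂ u| ≤ K * ‖z₁ - z₂‖
  Φ : ℕ → ∀ i : Fin n, EuclideanSpace ℝ (Fin (p i)) → EuclideanSpace ℝ (Fin (p i))
  hΦmaps : ∀ t i, ∀ z ∈ X i, Φ t i z ∈ X i
  hΦcontract : ∀ t i, ∀ z ∈ X i, ∀ u ∈ X i,
    breg (ψ i) (ψ' i) (Φ t i z) (Φ t i u) ≤ breg (ψ i) (ψ' i) z u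
  α : ℕ → ℝ
  β : ℕ → ℝ
  γ : ℕ → ℝ
  hαpos : ∀ t, 1 ≤ t → 0 < α t
  hβpos : ∀ t, 1 ≤ t → 0 < β t
  hγpos : ∀ t, 1 ≤ t → 0 < γ t
  hαanti : ∀ s t, 1 ≤ s → s ≤ t → α t ≤ α s
  hβanti : ∀ s t, 1 ≤ s → s ≤ t → β t ≤ β s
  hγanti : ∀ s t, 1 ≤ s → s ≤ t → γ t ≤ γ s
  x : ℕ → ∀ i : Fin n, EuclideanSpace ℝ (Fin (p i))
  xtil : ℕ → ∀ i : Fin n, EuclideanSpace ℝ (Fin (p i))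
  q : ℕ → Fin n → EuclideanSpace ℝ (Fin m)
  qtil : ℕ → Fin n → EuclideanSpace ℝ (Fin m)
  a : ℕ → ∀ i : Fin n, EuclideanSpace ℝ (Fin (p i))
  b : ℕ → Fin n → EuclideanSpace ℝ (Fin m)
  hx0 : ∀ i, x 0 i ∈ X i
  hq0 : ∀ i, q 0 i = 0
  hqtil : ∀ t, 1 ≤ t → ∀ i, qtil t i = ∑ j, W (t - 1) i j • q (t - 1) j
  ha : ∀ t, 1 ≤ t → ∀ i,
    a t i = Gf (t - 1) i (x (t - 1) i) + ∑ j, qtil t i j • Gg (t - 1) i (x (t - 1) i) j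
  hxtilmem : ∀ t, 1 ≤ t → ∀ i, xtil t i ∈ X i
  hxtilmin : ∀ t, 1 ≤ t → ∀ i, ∀ z ∈ X i,
    α t * ⟪xtil t i, a t i⟫ + α t * r (t - 1) i (xtil t i)
        + breg (ψ i) (ψ' i) (xtil t i) (x (t - 1) i)
      ≤ α t * ⟪z, a t i⟫ + α t * r (t - 1) i z + breg (ψ i) (ψ' i) z (x (t - 1) i)
  hb : ∀ t, 1 ≤ t → ∀ i,
    b t i = vecOf (fun j => ⟪Gg (t - 1) i (x (t - 1) i) j, xtil t i - x (t - 1) i⟫)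
      + g (t - 1) i (x (t - 1) i)
  hq : ∀ t, 1 ≤ t → ∀ i,
    q t i = posPart (qtil t i + γ t • (b t i - β t • qtil t i))
  hx : ∀ t, 1 ≤ t → ∀ i, x t i = Φ t i (xtil t i)

namespace Alg

variable {n m : ℕ} {p : Fin n → ℕ}

/-- Average dual variable `q̄_t`. -/
def qbar (S : Alg n m p) (t : ℕ) : EuclideanSpace ℝ (Fin m) :=
  (n : ℝ)⁻¹ • ∑ i, S.q t i

/-- `σ̲ = min_i σ_i`. -/
def sigmin (S : Alg n m p) : ℝ :=
  Finset.univ.inf' (Finset.univ_nonempty_iff.mpr ⟨⟨0, S.hn⟩⟩) S.σ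

/-- `τ = (1 − w/(2n²))⁻²`. -/
def tau (S : Alg n m p) : ℝ := ((1 - S.w / (2 * (n : ℝ) ^ 2)) ^ 2)⁻¹

/-- `λ = (1 − w/(2n²))^{1/ι}`. -/
def lam (S : Alg n m p) : ℝ := (1 - S.w / (2 * (n : ℝ) ^ 2)) ^ ((S.iota : ℝ))⁻¹

/-- `B₁ = 2F + G d(X)`. -/
def B1 (S : Alg n m p) : ℝ := 2 * S.F + S.G * S.dX

/-- `E₁(t) = n²τB₁F Σ_{s=1}^{t−1} γ_{s+1} λ^{t−1−s}`. -/
def E1 (S : Alg n m p) (t : ℕ) : ℝ :=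
  (n : ℝ) ^ 2 * S.tau * S.B1 * S.F *
    ∑ s ∈ Finset.Icc 1 (t - 1), S.γ (s + 1) * S.lam ^ (t - 1 - s)

/-- Global objective `f_t(y) = Σ_i (f_{i,t}(y_i) + r_{i,t}(y_i))`. -/
def fsum (S : Alg n m p) (t : ℕ) (y : ∀ i, EuclideanSpace ℝ (Fin (p i))) : ℝ :=
  ∑ i, (S.f t i (y i) + S.r t i (y i))

/-- Global constraint `g_t(y) = Σ_i g_{i,t}(y_i)`. -/
def gsum (S : Alg n m p) (t : ℕ) (y : ∀ i, EuclideanSpace ℝ (Fin (p i))) :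
    EuclideanSpace ℝ (Fin m) :=
  ∑ i, S.g t i (y i)

/-- Regret against a comparator sequence. -/
def reg (S : Alg n m p) (T : ℕ) (y : ℕ → ∀ i, EuclideanSpace ℝ (Fin (p i))) : ℝ :=
  ∑ t ∈ Finset.Icc 1 T, S.fsum t (S.x t) - ∑ t ∈ Finset.Icc 1 T, S.fsum t (y t)

/-- Feasibility of a comparator sequence on `1..T`. -/
def Feasible (S : Alg n m p) (T : ℕ) (y : ℕ → ∀ i, EuclideanSpace ℝ (Fin (p i))) : Prop :=
  ∀ t ∈ Finset.Icc 1 T, (∀ i, y t i ∈ S.X i) ∧ ∀ j, S.gsum t (y t) j ≤ 0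

/-- Accumulated dynamic variation `V_Φ(y_T)`. -/
def VPhi (S : Alg n m p) (T : ℕ) (y : ℕ → ∀ i, EuclideanSpace ℝ (Fin (p i))) : ℝ :=
  ∑ t ∈ Finset.Icc 1 (T - 1), ∑ i, ‖y (t + 1) i - S.Φ (t + 1) i (y t i)‖

/-- `E₂(t)` for a comparator sequence. -/
def E2 (S : Alg n m p) (y : ℕ → ∀ i, EuclideanSpace ℝ (Fin (p i))) (t : ℕ) : ℝ :=
  (S.α t)⁻¹ * ∑ i, (breg (S.ψ i) (S.ψ' i) (y (t - 1) i) (S.x (t - 1) i)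
    - breg (S.ψ i) (S.ψ' i) (y t i) (S.x t i))

/-- `C_{1,1} = 3n²τB₁F/(1−λ) + nB₁²/2`. -/
def C11 (S : Alg n m p) : ℝ :=
  3 * (n : ℝ) ^ 2 * S.tau * S.B1 * S.F / (1 - S.lam) + (n : ℝ) * S.B1 ^ 2 / 2

/-- `C_{1,2} = 4nG²/σ̲`. -/
def C12 (S : Alg n m p) : ℝ := 4 * (n : ℝ) * S.G ^ 2 / S.sigmin

/-- Constraint violation `‖[Σ_{t=1}^T g_t(x_t)]₊‖`. -/
def violation (S : Alg n m p) (T : ℕ) : ℝ :=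
  ‖posPart (∑ t ∈ Finset.Icc 1 T, S.gsum t (S.x t))‖

end Alg

/-! ### Averaging by doubly stochastic matrices -/

theorem weighted_variance_eq {n : ℕ} (a y : Fin n → ℝ) (ha : ∑ j, a j = 1) :
    2 * (∑ j, a j * y j ^ 2 - (∑ j, a j * y j) ^ 2)
      = ∑ j, ∑ l, a j * a l * (y j - y l) ^ 2 := by
  have h : ∀ j l, a j * a l * (y j - y l) ^ 2 =
      (a j * y j ^ 2) * a l + a j * (a l * y l ^ 2) - 2 * ((a j * y j) * (a l * y l)) := by
    intros; ring
  simp only [h, Finset.sum_add_distrib, Finset.sum_sub_distrib, ← Finset.mul_sum,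
    ← Finset.sum_mul, ha]
  ring

/-- The part of `b` lying in the layer between `s` and `t`. -/
def layer (s t b : ℝ) : ℝ := min b t - min b s

theorem layer_mono {s t a b : ℝ} (hst : s ≤ t) (hab : a ≤ b) : layer s t a ≤ layer s t b := by
  unfold layer
  rcases min_cases b t with h | h <;> rcases min_cases b s with h' | h' <;>
  rcases min_cases a t with k | k <;> rcases min_cases a s with k' | k' <;> linarith

theorem layer_of_le {s t b : ℝ} (hst : s ≤ t) (hb : b ≤ s) : layer s t b = 0 := by
  simp [layer, hb, hb.trans hst]

theorem layer_of_ge {s t b : ℝ} (hst : s ≤ t) (hb : t ≤ b) : layer s t b = t - s := by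
  simp [layer, hb, hst.trans hb]

theorem sum_layer_sq_le (u : ℕ → ℝ) (hu : Monotone u) (N : ℕ) (a b : ℝ) :
    ∑ d ∈ Finset.range N, (layer (u d) (u (d + 1)) a - layer (u d) (u (d + 1)) b) ^ 2
      ≤ (a - b) ^ 2 := by
  wlog hab : b ≤ a generalizing a b
  · have := this b a (le_of_not_ge hab)
    simpa only [sub_sq_comm] using this
  have h0 : ∀ d ∈ Finset.range N,
      0 ≤ layer (u d) (u (d + 1)) a - layer (u d) (u (d + 1)) b := fun d _ =>
    sub_nonneg.mpr (layer_mono (hu d.le_succ) hab)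
  have h1 : ∑ d ∈ Finset.range N, (layer (u d) (u (d + 1)) a - layer (u d) (u (d + 1)) b)
      ≤ a - b := by
    simp only [layer, Finset.sum_sub_distrib]
    have e := fun b : ℝ => Finset.sum_range_sub (fun d => min b (u d)) N
    simp only [Finset.sum_sub_distrib] at e
    rw [e, e]
    have := layer_mono (hu (Nat.zero_le N)) hab
    rcases min_cases a (u N) with h | h <;> rcases min_cases b (u N) with h' | h' <;>
    rcases min_cases a (u 0) with k | k <;> rcases min_cases b (u 0) with k' | k' <;> linarith
  calc _ ≤ (∑ d ∈ Finset.range N,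
        (layer (u d) (u (d + 1)) a - layer (u d) (u (d + 1)) b)) ^ 2 :=
        Finset.sum_sq_le_sq_sum_of_nonneg h0
    _ ≤ _ := pow_le_pow_left₀ (Finset.sum_nonneg h0) h1 2

theorem sum_layer_variance_le {n : ℕ} (a y : Fin n → ℝ) (ha0 : ∀ j, 0 ≤ a j)
    (ha : ∑ j, a j = 1) (u : ℕ → ℝ) (hu : Monotone u) (N : ℕ) :
    ∑ d ∈ Finset.range N, (∑ j, a j * layer (u d) (u (d + 1)) (y j) ^ 2
        - (∑ j, a j * layer (u d) (u (d + 1)) (y j)) ^ 2)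
      ≤ ∑ j, a j * y j ^ 2 - (∑ j, a j * y j) ^ 2 := by
  refine le_of_mul_le_mul_left ?_ (zero_lt_two' ℝ)
  rw [weighted_variance_eq a y ha, Finset.mul_sum]
  simp only [fun d => weighted_variance_eq a (fun j => layer (u d) (u (d + 1)) (y j)) ha]
  rw [Finset.sum_comm]
  refine Finset.sum_le_sum fun j _ => ?_
  rw [Finset.sum_comm]
  refine Finset.sum_le_sum fun l _ => ?_
  rw [← Finset.mul_sum]
  exact mul_le_mul_of_nonneg_left (sum_layer_sq_le u hu N _ _) (mul_nonneg (ha0 j) (ha0 l))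

theorem weighted_variance_nonneg {n : ℕ} (a y : Fin n → ℝ) (ha0 : ∀ j, 0 ≤ a j)
    (ha : ∑ j, a j = 1) : 0 ≤ ∑ j, a j * y j ^ 2 - (∑ j, a j * y j) ^ 2 := by
  have := weighted_variance_eq a y ha
  have : 0 ≤ ∑ j, ∑ l, a j * a l * (y j - y l) ^ 2 :=
    Finset.sum_nonneg fun j _ => Finset.sum_nonneg fun l _ =>
      mul_nonneg (mul_nonneg (ha0 j) (ha0 l)) (sq_nonneg _)
  linarith

/-- A doubly stochastic matrix whose diagonal and positive entries are at least `w`. -/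
structure IsMixing {n : ℕ} (w : ℝ) (A : Matrix (Fin n) (Fin n) ℝ) : Prop where
  nonneg : ∀ i j, 0 ≤ A i j
  row : ∀ i, ∑ j, A i j = 1
  col : ∀ j, ∑ i, A i j = 1
  diag : ∀ i, w ≤ A i i
  pos : ∀ i j, 0 < A i j → w ≤ A i j

/-- Some edge of `A` joins the set `s` and its complement. -/
def Crosses {n : ℕ} (A : Matrix (Fin n) (Fin n) ℝ) (s : Fin n → Prop) : Prop :=
  ∃ i j, 0 < A i j ∧ ¬ (s i ↔ s j)

theorem IsMixing.energy_sub {n : ℕ} {w : ℝ} {A : Matrix (Fin n) (Fin n) ℝ} (hA : IsMixing w A)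
    (y : Fin n → ℝ) :
    ∑ j, y j ^ 2 - ∑ i, (∑ j, A i j * y j) ^ 2
      = ∑ i, (∑ j, A i j * y j ^ 2 - (∑ j, A i j * y j) ^ 2) := by
  rw [Finset.sum_sub_distrib, Finset.sum_comm]
  simp only [← Finset.sum_mul, hA.col, one_mul]

theorem IsMixing.energy_le {n : ℕ} {w : ℝ} {A : Matrix (Fin n) (Fin n) ℝ} (hA : IsMixing w A)
    (y : Fin n → ℝ) : ∑ i, (∑ j, A i j * y j) ^ 2 ≤ ∑ j, y j ^ 2 := by
  have h := hA.energy_sub y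
  have : 0 ≤ ∑ i, (∑ j, A i j * y j ^ 2 - (∑ j, A i j * y j) ^ 2) :=
    Finset.sum_nonneg fun i _ => weighted_variance_nonneg _ _ (hA.nonneg i) (hA.row i)
  linarith

theorem IsMixing.variance_layer_ge {n : ℕ} {w : ℝ} (hw : 0 < w) {A : Matrix (Fin n) (Fin n) ℝ}
    (hA : IsMixing w A) (s : Fin n → Prop) (hcross : Crosses A s) (φ : Fin n → ℝ) (δ : ℝ)
    (hφ0 : ∀ j, s j → φ j = 0) (hφ1 : ∀ j, ¬ s j → φ j = δ) :
    w / 2 * δ ^ 2 ≤ ∑ i, (∑ j, A i j * φ j ^ 2 - (∑ j, A i j * φ j) ^ 2) := by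
  classical
  obtain ⟨i, j, hij, hs⟩ := hcross
  have hφ : ∀ l, φ l = δ * (if s l then 0 else 1) := fun l => by
    by_cases h : s l
    · simp [h, hφ0 l h]
    · simp [h, hφ1 l h]
  set p : ℝ := ∑ l, A i l * (if s l then 0 else 1) with hp
  set p' : ℝ := ∑ l, A i l * (if s l then 1 else 0) with hp'
  have hpp : p + p' = 1 := by
    rw [hp, hp', ← Finset.sum_add_distrib]
    refine (Finset.sum_congr rfl fun l _ => ?_).trans (hA.row i)
    split_ifs <;> ring
  have hwp : ∀ l, 0 < A i l → ¬ s l → w ≤ p := fun l hl hsl => by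
    calc w ≤ A i l * (if s l then 0 else 1) := by simpa [hsl] using hA.pos i l hl
      _ ≤ p := Finset.single_le_sum (f := fun l => A i l * (if s l then (0 : ℝ) else 1))
          (fun l _ => mul_nonneg (hA.nonneg i l) (by split_ifs <;> norm_num)) (Finset.mem_univ l)
  have hwp' : ∀ l, 0 < A i l → s l → w ≤ p' := fun l hl hsl => by
    calc w ≤ A i l * (if s l then 1 else 0) := by simpa [hsl] using hA.pos i l hl
      _ ≤ p' := Finset.single_le_sum (f := fun l => A i l * (if s l then (1 : ℝ) else 0))
          (fun l _ => mul_nonneg (hA.nonneg i l) (by split_ifs <;> norm_num)) (Finset.mem_univ l)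
  have hii : 0 < A i i := hw.trans_le (hA.diag i)
  have hb : w ≤ p ∧ w ≤ p' := by
    by_cases hsi : s i
    · exact ⟨hwp j hij (by tauto), hwp' i hii hsi⟩
    · exact ⟨hwp i hii hsi, hwp' j hij (by tauto)⟩
  have hrow : ∑ l, A i l * φ l ^ 2 - (∑ l, A i l * φ l) ^ 2 = p * p' * δ ^ 2 := by
    have e1 : ∑ l, A i l * φ l ^ 2 = p * δ ^ 2 := by
      rw [hp, Finset.sum_mul]
      refine Finset.sum_congr rfl fun l _ => ?_
      rw [hφ]; split_ifs <;> ring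
    have e2 : ∑ l, A i l * φ l = p * δ := by
      rw [hp, Finset.sum_mul]
      refine Finset.sum_congr rfl fun l _ => ?_
      rw [hφ]; ring
    rw [e1, e2, show p' = 1 - p by linarith]; ring
  calc w / 2 * δ ^ 2 ≤ p * p' * δ ^ 2 := by
        refine mul_le_mul_of_nonneg_right ?_ (sq_nonneg δ)
        have h1 : p' = 1 - p := by linarith
        have h2 := mul_nonneg (sub_nonneg.mpr hb.1) (sub_nonneg.mpr hb.2)
        have h3 : 0 ≤ w * (1 - 2 * w) := mul_nonneg hw.le (by linarith [hb.1, hb.2])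
        rw [h1] at h2 ⊢
        linarith
    _ = _ := hrow.symm
    _ ≤ _ := Finset.single_le_sum
        (f := fun i => ∑ j, A i j * φ j ^ 2 - (∑ j, A i j * φ j) ^ 2)
        (fun i _ => weighted_variance_nonneg _ _ (hA.nonneg i) (hA.row i)) (Finset.mem_univ i)

theorem exists_crosses {n : ℕ} (A : ℕ → Matrix (Fin n) (Fin n) ℝ) (ι : ℕ)
    (hconn : ∀ c d : Fin n, Relation.ReflTransGen (fun u v => ∃ l < ι, 0 < A l v u) c d)
    (s : Fin n → Prop) {c d : Fin n} (hc : s c) (hd : ¬ s d) : ∃ l < ι, Crosses (A l) s := by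
  by_contra! hno
  refine hd ?_
  induction hconn c d with
  | refl => exact hc
  | tail _ hstep ih =>
    rename_i u v _
    by_contra hv
    have hu : s u := by
      by_contra hu
      exact hu (ih hu)
    obtain ⟨l, hl, hpos⟩ := hstep
    exact hno l hl ⟨_, _, hpos, by tauto⟩

theorem IsMixing.separated_of_not_crosses {n : ℕ} {w : ℝ} {A : Matrix (Fin n) (Fin n) ℝ}
    (hA : IsMixing w A) {s : Fin n → Prop} (hs : ¬ Crosses A s) {y : Fin n → ℝ} {a b : ℝ}
    (ha : ∀ j, s j → y j ≤ a) (hb : ∀ j, ¬ s j → b ≤ y j) :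
    (∀ i, s i → ∑ j, A i j * y j ≤ a) ∧ (∀ i, ¬ s i → b ≤ ∑ j, A i j * y j) := by
  have hz : ∀ i j, ¬ (s i ↔ s j) → A i j = 0 := fun i j h => by
    by_contra h0
    exact hs ⟨i, j, lt_of_le_of_ne (hA.nonneg i j) (Ne.symm h0), h⟩
  refine ⟨fun i hi => ?_, fun i hi => ?_⟩
  · rw [← one_mul a, ← hA.row i, Finset.sum_mul]
    refine Finset.sum_le_sum fun j _ => ?_
    by_cases hj : s j
    · exact mul_le_mul_of_nonneg_left (ha j hj) (hA.nonneg i j)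
    · simp [hz i j (by tauto)]
  · rw [← one_mul b, ← hA.row i, Finset.sum_mul]
    refine Finset.sum_le_sum fun j _ => ?_
    by_cases hj : s j
    · simp [hz i j (by tauto)]
    · exact mul_le_mul_of_nonneg_left (hb j hj) (hA.nonneg i j)

section Window

variable {n : ℕ} {w : ℝ} {A : ℕ → Matrix (Fin n) (Fin n) ℝ} {y : ℕ → Fin n → ℝ} {ι : ℕ}

theorem energy_window_sub_ge (hw : 0 < w) (hA : ∀ k, IsMixing w (A k))
    (hconn : ∀ c d : Fin n, Relation.ReflTransGen (fun u v => ∃ l < ι, 0 < A l v u) c d)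
    (hy : ∀ k i, y (k + 1) i = ∑ j, A k i j * y k j) (u : ℕ → ℝ) (hu : Monotone u) (N : ℕ)
    (hgap : ∀ d < N, ∀ j, y 0 j ≤ u d ∨ u (d + 1) ≤ y 0 j)
    (hlow : ∀ d < N, ∃ j, y 0 j ≤ u d) (hhigh : ∀ d < N, ∃ j, u (d + 1) ≤ y 0 j) :
    w / 2 * ∑ d ∈ Finset.range N, (u (d + 1) - u d) ^ 2
      ≤ ∑ j, y 0 j ^ 2 - ∑ j, y ι j ^ 2 := by
  set v : ℕ → ℕ → Fin n → ℝ := fun d k i =>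
    ∑ j, A k i j * layer (u d) (u (d + 1)) (y k j) ^ 2
      - (∑ j, A k i j * layer (u d) (u (d + 1)) (y k j)) ^ 2 with hv
  have hv0 : ∀ d k i, 0 ≤ v d k i := fun d k i =>
    weighted_variance_nonneg (A k i) (fun j => layer (u d) (u (d + 1)) (y k j))
      ((hA k).nonneg i) ((hA k).row i)
  have htot : ∑ j, y 0 j ^ 2 - ∑ j, y ι j ^ 2
      = ∑ k ∈ Finset.range ι, (∑ j, y k j ^ 2 - ∑ j, y (k + 1) j ^ 2) := by
    rw [Finset.sum_range_sub']
  have hstep : ∀ k, ∑ d ∈ Finset.range N, ∑ i, v d k i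
      ≤ ∑ j, y k j ^ 2 - ∑ j, y (k + 1) j ^ 2 := fun k => by
    simp only [hy]
    rw [(hA k).energy_sub, Finset.sum_comm]
    exact Finset.sum_le_sum fun i _ =>
      sum_layer_variance_le (A k i) (y k) ((hA k).nonneg i) ((hA k).row i) u hu N
  have hd : ∀ d ∈ Finset.range N, w / 2 * (u (d + 1) - u d) ^ 2
      ≤ ∑ k ∈ Finset.range ι, ∑ i, v d k i := fun d hd => by
    rw [Finset.mem_range] at hd
    have hle : u d ≤ u (d + 1) := hu d.le_succ
    rcases hle.eq_or_lt with heq | hlt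
    · rw [heq]
      simpa using Finset.sum_nonneg fun k _ => Finset.sum_nonneg fun i _ => hv0 d k i
    obtain ⟨c, hc⟩ := hlow d hd
    obtain ⟨e, he⟩ := hhigh d hd
    have hex := exists_crosses A ι hconn (fun j => y 0 j ≤ u d) hc (d := e)
      (not_le.mpr (hlt.trans_le he))
    classical
    set k := Nat.find hex with hk
    obtain ⟨hkι, hcross⟩ := Nat.find_spec hex
    have hmin : ∀ l < k, ¬ Crosses (A l) (fun j => y 0 j ≤ u d) := fun l hl hcr =>
      Nat.find_min hex hl ⟨hl.trans hkι, hcr⟩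
    have hsep : ∀ l ≤ k, (∀ j, y 0 j ≤ u d → y l j ≤ u d) ∧
        (∀ j, ¬ y 0 j ≤ u d → u (d + 1) ≤ y l j) := by
      intro l
      induction l with
      | zero => exact fun _ => ⟨fun _ h => h, fun j h => (hgap d hd j).resolve_left h⟩
      | succ l ih =>
        intro hl
        obtain ⟨h1, h2⟩ := ih (by omega)
        simp only [hy]
        exact (hA l).separated_of_not_crosses (hmin l (by omega)) h1 h2
    obtain ⟨h1, h2⟩ := hsep k le_rfl
    refine le_trans ?_ (Finset.single_le_sum (f := fun k => ∑ i, v d k i)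
      (fun k _ => Finset.sum_nonneg fun i _ => hv0 d k i) (Finset.mem_range.mpr hkι))
    exact (hA k).variance_layer_ge hw _ hcross (fun j => layer (u d) (u (d + 1)) (y k j)) _
      (fun j hj => layer_of_le hle (h1 j hj)) (fun j hj => layer_of_ge hle (h2 j hj))
  rw [htot, Finset.mul_sum]
  refine (Finset.sum_le_sum hd).trans ?_
  rw [Finset.sum_comm]
  exact Finset.sum_le_sum fun k _ => hstep k

theorem sum_sq_sub_le_sum_sq_gap (u : ℕ → ℝ) (n : ℕ) :
    ∑ k ∈ Finset.range n, (u k - u 0) ^ 2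
      ≤ (n : ℝ) ^ 2 / 2 * ∑ d ∈ Finset.range (n - 1), (u (d + 1) - u d) ^ 2 := by
  set Q := ∑ d ∈ Finset.range (n - 1), (u (d + 1) - u d) ^ 2 with hQ
  have hQ0 : 0 ≤ Q := Finset.sum_nonneg fun _ _ => sq_nonneg _
  have h : ∀ k ∈ Finset.range n, (u k - u 0) ^ 2 ≤ k * Q := fun k hk => by
    rw [Finset.mem_range] at hk
    rw [← Finset.sum_range_sub]
    have h1 := sq_sum_le_card_mul_sum_sq (s := Finset.range k) (f := fun d => u (d + 1) - u d)
    rw [Finset.card_range] at h1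
    refine h1.trans (mul_le_mul_of_nonneg_left ?_ k.cast_nonneg)
    exact Finset.sum_le_sum_of_subset_of_nonneg (by gcongr; omega) fun _ _ _ => sq_nonneg _
  refine (Finset.sum_le_sum h).trans ?_
  rw [← Finset.sum_mul]
  refine mul_le_mul_of_nonneg_right ?_ hQ0
  have : ∀ n : ℕ, ∑ k ∈ Finset.range n, (k : ℝ) ≤ (n : ℝ) ^ 2 / 2 := fun n => by
    induction n with
    | zero => simp
    | succ n ih => rw [Finset.sum_range_succ]; push_cast; nlinarith
  exact this n

/-- Over a jointly connected window of length `ι`, the energy of a centred vector contracts. -/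
theorem energy_window_le (hw : 0 < w) (hA : ∀ k, IsMixing w (A k))
    (hconn : ∀ c d : Fin n, Relation.ReflTransGen (fun u v => ∃ l < ι, 0 < A l v u) c d)
    (hy : ∀ k i, y (k + 1) i = ∑ j, A k i j * y k j) (hmean : ∑ j, y 0 j = 0) :
    ∑ j, y ι j ^ 2 ≤ (1 - w / (2 * (n : ℝ) ^ 2)) ^ 2 * ∑ j, y 0 j ^ 2 := by
  rcases Nat.eq_zero_or_pos n with rfl | hn
  · simp
  set π := Tuple.sort (y 0) with hπ
  have hmono : Monotone (y 0 ∘ π) := Tuple.monotone_sort (y 0)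
  have hlt : ∀ k, min k (n - 1) < n := fun k => by omega
  set u : ℕ → ℝ := fun k => y 0 (π ⟨min k (n - 1), hlt k⟩) with hu_def
  have hu : Monotone u := fun a b hab => hmono (Fin.mk_le_mk.mpr (min_le_min_right _ hab))
  have hval : ∀ j, y 0 j = u (π.symm j) := fun j => by
    have : min (π.symm j : ℕ) (n - 1) = π.symm j := by omega
    simp [hu_def, this]
  have key := energy_window_sub_ge hw hA hconn hy u hu (n - 1)
    (fun d _ j => by
      rw [hval j]
      rcases Nat.lt_or_ge d (π.symm j) with h | h
      · exact Or.inr (hu h)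
      · exact Or.inl (hu h))
    (fun d _ => ⟨_, le_rfl⟩) (fun d _ => ⟨_, le_rfl⟩)
  have hsum : ∑ j, (y 0 j - u 0) ^ 2 = ∑ k ∈ Finset.range n, (u k - u 0) ^ 2 := by
    simp only [hval]
    rw [Equiv.sum_comp π.symm (fun k : Fin n => (u k - u 0) ^ 2),
      Fin.sum_univ_eq_sum_range (fun k => (u k - u 0) ^ 2)]
  have hcent : ∑ j, (y 0 j - u 0) ^ 2 = ∑ j, y 0 j ^ 2 + n * u 0 ^ 2 := by
    have : ∀ j, (y 0 j - u 0) ^ 2 = y 0 j ^ 2 - 2 * u 0 * y 0 j + u 0 ^ 2 := fun j => by ring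
    simp only [this, Finset.sum_add_distrib, Finset.sum_sub_distrib, ← Finset.mul_sum, hmean]
    simp
  have hgap := sum_sq_sub_le_sum_sq_gap u n
  have hn' : (0 : ℝ) < n := by exact_mod_cast hn
  have hn2 : (0 : ℝ) < (n : ℝ) ^ 2 := by positivity
  set V := ∑ j, y 0 j ^ 2
  set Q := ∑ d ∈ Finset.range (n - 1), (u (d + 1) - u d) ^ 2
  have hVQ : V ≤ (n : ℝ) ^ 2 / 2 * Q := by nlinarith [mul_nonneg hn'.le (sq_nonneg (u 0))]
  have hV0 : 0 ≤ V := Finset.sum_nonneg fun _ _ => sq_nonneg _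
  have h3 : w / (n : ℝ) ^ 2 * V ≤ w / 2 * Q := by
    calc w / (n : ℝ) ^ 2 * V ≤ w / (n : ℝ) ^ 2 * ((n : ℝ) ^ 2 / 2 * Q) := by gcongr
      _ = w / 2 * Q := by field_simp
  have h4 : (1 - w / (2 * (n : ℝ) ^ 2)) ^ 2 * V
      = V - w / (n : ℝ) ^ 2 * V + (w / (2 * (n : ℝ) ^ 2)) ^ 2 * V := by
    field_simp; ring
  have h5 : 0 ≤ (w / (2 * (n : ℝ) ^ 2)) ^ 2 * V := by positivity
  linarith

end Window

/-! ### Mixing vector-valued states -/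

section Evolution

variable {n m : ℕ}

/-- States of `n` agents holding vectors in `ℝ^m`. -/
abbrev AgentState (n m : ℕ) : Type := PiLp 2 (fun _ : Fin n => EuclideanSpace ℝ (Fin m))

/-- One averaging step with weights `A`. -/
def mix (A : Matrix (Fin n) (Fin n) ℝ) (x : AgentState n m) : AgentState n m :=
  WithLp.toLp 2 fun i => ∑ j, A i j • x j

/-- `k` averaging steps starting at time `s`. -/
def evolve (W : ℕ → Matrix (Fin n) (Fin n) ℝ) (s : ℕ) : ℕ → AgentState n m → AgentState n m
  | 0, x => x
  | k + 1, x => mix (W (s + k)) (evolve W s k x)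

theorem mix_apply (A : Matrix (Fin n) (Fin n) ℝ) (x : AgentState n m) (i : Fin n) :
    mix A x i = ∑ j, A i j • x j := rfl

theorem mix_coord (A : Matrix (Fin n) (Fin n) ℝ) (x : AgentState n m) (i : Fin n) (c : Fin m) :
    mix A x i c = ∑ j, A i j * x j c := by
  simp [mix_apply]

theorem mix_add (A : Matrix (Fin n) (Fin n) ℝ) (x y : AgentState n m) :
    mix A (x + y) = mix A x + mix A y := by
  ext i c
  simp [mix_coord, mul_add, Finset.sum_add_distrib]

theorem evolve_add (W : ℕ → Matrix (Fin n) (Fin n) ℝ) (s k : ℕ) (x y : AgentState n m) :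
    evolve W s k (x + y) = evolve W s k x + evolve W s k y := by
  induction k with
  | zero => rfl
  | succ k ih => simp only [evolve, ih, mix_add]

theorem evolve_comp (W : ℕ → Matrix (Fin n) (Fin n) ℝ) (s k l : ℕ) (x : AgentState n m) :
    evolve W s (k + l) x = evolve W (s + k) l (evolve W s k x) := by
  induction l with
  | zero => rfl
  | succ l ih =>
    rw [← Nat.add_assoc]
    simp only [evolve, ih, Nat.add_assoc]

theorem AgentState.norm_sq (x : AgentState n m) : ‖x‖ ^ 2 = ∑ c, ∑ i, x i c ^ 2 := by
  rw [PiLp.norm_sq_eq_of_L2, Finset.sum_comm]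
  refine Finset.sum_congr rfl fun i _ => ?_
  rw [EuclideanSpace.real_norm_sq_eq]

theorem sum_mix {w : ℝ} {A : Matrix (Fin n) (Fin n) ℝ} (hA : IsMixing w A)
    (x : AgentState n m) : ∑ i, mix A x i = ∑ i, x i := by
  simp only [mix_apply]
  rw [Finset.sum_comm]
  simp only [← Finset.sum_smul, hA.col, one_smul]

theorem norm_mix_le {w : ℝ} {A : Matrix (Fin n) (Fin n) ℝ} (hA : IsMixing w A)
    (x : AgentState n m) : ‖mix A x‖ ≤ ‖x‖ := by
  refine le_of_sq_le_sq ?_ (norm_nonneg _)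
  rw [AgentState.norm_sq, AgentState.norm_sq]
  refine Finset.sum_le_sum fun c _ => ?_
  simp only [mix_coord]
  exact hA.energy_le fun j => x j c

variable {w : ℝ} {W : ℕ → Matrix (Fin n) (Fin n) ℝ} {ι : ℕ}

theorem sum_evolve (hW : ∀ t, IsMixing w (W t)) (s k : ℕ) (x : AgentState n m) :
    ∑ i, evolve W s k x i = ∑ i, x i := by
  induction k with
  | zero => rfl
  | succ k ih => rw [evolve, sum_mix (hW _), ih]

theorem norm_evolve_le (hW : ∀ t, IsMixing w (W t)) (s k : ℕ) (x : AgentState n m) :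
    ‖evolve W s k x‖ ≤ ‖x‖ := by
  induction k with
  | zero => rfl
  | succ k ih => exact (norm_mix_le (hW _) _).trans ih

theorem norm_evolve_window_le (hw : 0 < w) (hρ : 0 ≤ 1 - w / (2 * (n : ℝ) ^ 2))
    (hW : ∀ t, IsMixing w (W t))
    (hconn : ∀ (t : ℕ) (c d : Fin n),
      Relation.ReflTransGen (fun u v : Fin n => ∃ l < ι, 0 < W (t + l) v u) c d)
    (s : ℕ) (x : AgentState n m) (hx : ∑ i, x i = 0) :
    ‖evolve W s ι x‖ ≤ (1 - w / (2 * (n : ℝ) ^ 2)) * ‖x‖ := by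
  refine le_of_sq_le_sq ?_ (by positivity)
  rw [mul_pow, AgentState.norm_sq, AgentState.norm_sq, Finset.mul_sum]
  refine Finset.sum_le_sum fun c _ => ?_
  refine energy_window_le (A := fun k => W (s + k)) (y := fun k i => evolve W s k x i c) hw
    (fun k => hW _) (hconn s) (fun k i => by simp only [evolve, mix_coord]) ?_
  simpa [evolve] using congrArg (fun v : EuclideanSpace ℝ (Fin m) => v c) hx

theorem norm_evolve_le_geometric (hw : 0 < w) (hρ0 : 0 < 1 - w / (2 * (n : ℝ) ^ 2))
    (hι : 0 < ι) (hW : ∀ t, IsMixing w (W t))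
    (hconn : ∀ (t : ℕ) (c d : Fin n),
      Relation.ReflTransGen (fun u v : Fin n => ∃ l < ι, 0 < W (t + l) v u) c d)
    (s k : ℕ) (x : AgentState n m) (hx : ∑ i, x i = 0) :
    ‖evolve W s k x‖ ≤ ((1 - w / (2 * (n : ℝ) ^ 2)) ^ 2)⁻¹ *
      ((1 - w / (2 * (n : ℝ) ^ 2)) ^ (ι : ℝ)⁻¹) ^ k * ‖x‖ := by
  set ρ := 1 - w / (2 * (n : ℝ) ^ 2) with hρ
  have hρ1 : ρ ≤ 1 := by
    have : 0 ≤ w / (2 * (n : ℝ) ^ 2) := by positivity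
    linarith
  set μ := ρ ^ (ι : ℝ)⁻¹ with hμ
  have hμ0 : 0 ≤ μ := Real.rpow_nonneg hρ0.le _
  have hμ1 : μ ≤ 1 := Real.rpow_le_one hρ0.le hρ1 (by positivity)
  have hμι : μ ^ ι = ρ := Real.rpow_inv_natCast_pow hρ0.le hι.ne'
  have hblock : ∀ a : ℕ, ‖evolve W s (ι * a) x‖ ≤ ρ ^ a * ‖x‖ := fun a => by
    induction a with
    | zero => simp [evolve]
    | succ a ih =>
      rw [Nat.mul_succ, evolve_comp]
      refine (norm_evolve_window_le hw hρ0.le hW hconn _ _ ?_).trans ?_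
      · rw [sum_evolve hW, hx]
      · rw [pow_succ' ρ, mul_assoc]
        exact mul_le_mul_of_nonneg_left ih hρ0.le
  have hk : k = ι * (k / ι) + k % ι := (Nat.div_add_mod k ι).symm
  have hr : ρ ≤ μ ^ (k % ι) := by
    rw [← hμι]
    exact pow_le_pow_of_le_one hμ0 hμ1 (Nat.mod_lt _ hι).le
  have h1 : ‖evolve W s k x‖ ≤ ρ ^ (k / ι) * ‖x‖ := by
    conv_lhs => rw [hk, evolve_comp]
    exact (norm_evolve_le hW _ _ _).trans (hblock _)
  refine h1.trans (mul_le_mul_of_nonneg_right ?_ (norm_nonneg _))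
  have h2 : μ ^ k = ρ ^ (k / ι) * μ ^ (k % ι) := by
    conv_lhs => rw [hk, pow_add, pow_mul, hμι]
  rw [h2, inv_mul_eq_div, le_div_iff₀ (by positivity)]
  refine mul_le_mul_of_nonneg_left ?_ (by positivity)
  nlinarith

/-- Perturbed averaging with centred perturbations of size at most `M * γ t`. -/
theorem norm_mix_perturbed_le (hw : 0 < w) (hρ0 : 0 < 1 - w / (2 * (n : ℝ) ^ 2))
    (hι : 0 < ι) (hW : ∀ t, IsMixing w (W t))
    (hconn : ∀ (t : ℕ) (c d : Fin n),
      Relation.ReflTransGen (fun u v : Fin n => ∃ l < ι, 0 < W (t + l) v u) c d)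
    (δ η : ℕ → AgentState n m) (h0 : δ 0 = 0) (hδ : ∀ t, δ (t + 1) = mix (W t) (δ t) + η (t + 1))
    (hη : ∀ t, ∑ i, η t i = 0) (M : ℝ) (γ C : ℕ → ℝ) (hηM : ∀ t, 1 ≤ t → ‖η t‖ ≤ M * γ t)
    (hC0 : C 0 = 0)
    (hC : ∀ t, C (t + 1) = (1 - w / (2 * (n : ℝ) ^ 2)) ^ (ι : ℝ)⁻¹ * C t + γ (t + 1))
    (t k : ℕ) :
    ‖evolve W t k (δ t)‖ ≤ M * ((1 - w / (2 * (n : ℝ) ^ 2)) ^ 2)⁻¹ *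
      ((1 - w / (2 * (n : ℝ) ^ 2)) ^ (ι : ℝ)⁻¹) ^ k * C t := by
  induction t generalizing k with
  | zero =>
    rw [h0, hC0]
    simpa using norm_evolve_le hW 0 k (0 : AgentState n m)
  | succ t ih =>
    have e : evolve W (t + 1) k (mix (W t) (δ t)) = evolve W t (k + 1) (δ t) := by
      rw [Nat.add_comm k 1, evolve_comp]; rfl
    rw [hδ, evolve_add, e]
    refine (norm_add_le _ _).trans ?_
    have h1 := ih (k + 1)
    have h2 := norm_evolve_le_geometric hw hρ0 hι hW hconn (t + 1) k (η (t + 1)) (hη _)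
    have h3 := mul_le_mul_of_nonneg_left (hηM (t + 1) (by omega))
      (show 0 ≤ ((1 - w / (2 * (n : ℝ) ^ 2)) ^ 2)⁻¹ *
        ((1 - w / (2 * (n : ℝ) ^ 2)) ^ (ι : ℝ)⁻¹) ^ k by positivity)
    rw [hC]
    rw [pow_succ _ k] at h1
    linarith

end Evolution

/-! ### Scalar sums -/

theorem sum_inv_rpow_le {θ : ℝ} (h0 : 0 < θ) (h1 : θ < 1) (T : ℕ) :
    ∑ t ∈ Finset.Icc 1 T, ((t : ℝ) ^ (1 - θ))⁻¹ ≤ (T : ℝ) ^ θ / θ := by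
  induction T with
  | zero => simp [h0.ne']
  | succ T ih =>
    rw [Finset.sum_Icc_succ_top (by omega)]
    have hx : (0 : ℝ) < ((T + 1 : ℕ) : ℝ) := by positivity
    set x : ℝ := ((T + 1 : ℕ) : ℝ) with hx'
    have hT : (T : ℝ) = x * (1 + -x⁻¹) := by
      field_simp; rw [hx']; push_cast; ring
    have hx1 : x⁻¹ ≤ 1 := inv_le_one_of_one_le₀ (by rw [hx']; push_cast; linarith [T.cast_nonneg (α := ℝ)])
    have hb : (1 + -x⁻¹) ^ θ ≤ 1 + θ * -x⁻¹ :=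
      rpow_one_add_le_one_add_mul_self (by linarith) h0.le h1.le
    have hp : (T : ℝ) ^ θ ≤ x ^ θ * (1 + θ * -x⁻¹) := by
      rw [hT, Real.mul_rpow hx.le (by linarith)]
      exact mul_le_mul_of_nonneg_left hb (by positivity)
    have he : (x ^ (1 - θ))⁻¹ = x ^ θ * x⁻¹ := by
      rw [← Real.rpow_neg hx.le, ← Real.rpow_neg_one x, ← Real.rpow_add hx]
      ring_nf
    rw [he]
    have : (T : ℝ) ^ θ / θ ≤ x ^ θ / θ - x ^ θ * x⁻¹ := by
      rw [div_le_iff₀ h0, sub_mul, div_mul_cancel₀ _ h0.ne']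
      linarith
    linarith

theorem rpow_succ_sub_le {κ : ℝ} (h0 : 0 < κ) {x : ℝ} (hx : 0 < x) :
    (x + 1) ^ (1 - κ) - x ^ (1 - κ) ≤ ((x + 1) ^ κ)⁻¹ := by
  have hx1 : 0 < x + 1 := by linarith
  have hle : x * ((x + 1) ^ κ)⁻¹ ≤ x * (x ^ κ)⁻¹ := by
    gcongr; linarith
  rw [Real.rpow_sub hx1, Real.rpow_sub hx, Real.rpow_one, Real.rpow_one, div_eq_mul_inv,
    div_eq_mul_inv]
  linarith

theorem sum_geometric_convolution_le {μ : ℝ} (h1 : μ < 1) (γ C : ℕ → ℝ)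
    (hC0 : C 0 = 0) (hC : ∀ t, C (t + 1) = μ * C t + γ (t + 1)) (T : ℕ) :
    ∑ t ∈ Finset.Icc 1 T, C t + μ / (1 - μ) * C T
      ≤ (∑ t ∈ Finset.Icc 1 T, γ t) / (1 - μ) := by
  have h : 0 < 1 - μ := by linarith
  induction T with
  | zero => simp [hC0]
  | succ T ih =>
    rw [Finset.sum_Icc_succ_top (by omega), Finset.sum_Icc_succ_top (by omega), hC, add_div]
    have : (μ * C T + γ (T + 1)) + μ / (1 - μ) * (μ * C T + γ (T + 1))
        = μ / (1 - μ) * C T + γ (T + 1) / (1 - μ) := by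
      field_simp; ring
    linarith

/-- Summation by parts for a drifting nonnegative potential. -/
theorem sum_weighted_drift_le (ω D D' v : ℕ → ℝ) (M K : ℝ) (hω0 : ∀ t, 0 ≤ ω t)
    (hω : Monotone ω) (hK : 0 ≤ K) (hv : ∀ t, 0 ≤ v t) (N : ℕ)
    (hDM : ∀ t, 1 ≤ t → t ≤ N + 1 → D t ≤ M) (hD' : 0 ≤ D' (N + 1))
    (hDD : ∀ t, 1 ≤ t → t ≤ N → D (t + 1) - K * v t ≤ D' t) :
    ∑ t ∈ Finset.Icc 1 (N + 1), ω (t + 1) * (D t - D' t)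
      ≤ ω (N + 2) * M + K * ω (N + 1) * ∑ t ∈ Finset.Icc 1 N, v t := by
  have hM : ∀ k ≤ N, ∑ t ∈ Finset.Icc 1 k, ω (t + 1) * (D t - D' t)
      ≤ ω (k + 1) * (M - D (k + 1)) + K * ω (k + 1) * ∑ t ∈ Finset.Icc 1 k, v t := by
    intro k
    induction k with
    | zero =>
      intro _
      simpa using mul_nonneg (hω0 1) (sub_nonneg.mpr (hDM 1 le_rfl (by omega)))
    | succ k ih =>
      intro hk
      rw [Finset.sum_Icc_succ_top (by omega), Finset.sum_Icc_succ_top (by omega)]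
      have h1 := ih (by omega)
      have hωk : ω (k + 1) ≤ ω (k + 1 + 1) := hω (Nat.le_succ _)
      have h2 := mul_le_mul_of_nonneg_left (hDD (k + 1) (by omega) hk) (hω0 (k + 1 + 1))
      have h3 := mul_le_mul_of_nonneg_right hωk
        (sub_nonneg.mpr (hDM (k + 1) (by omega) (by omega)))
      have h4 := mul_le_mul_of_nonneg_right hωk
        (mul_nonneg hK (Finset.sum_nonneg fun t (_ : t ∈ Finset.Icc 1 k) => hv t))
      linarith
  rw [Finset.sum_Icc_succ_top (by omega)]
  have h1 := hM N le_rfl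
  have h2 := mul_le_mul_of_nonneg_right (hω (Nat.le_succ (N + 1)))
    (sub_nonneg.mpr (hDM (N + 1) (by omega) le_rfl))
  have h3 := mul_nonneg (hω0 (N + 1 + 1)) hD'
  simp only [Nat.succ_eq_add_one] at h2
  rw [show N + 2 = N + 1 + 1 from rfl]
  linarith

/-! ### Positive parts -/

section PosPart

variable {d : ℕ}

theorem posPart_coord (v : EuclideanSpace ℝ (Fin d)) (j : Fin d) :
    posPart v j = max (v j) 0 := rfl

theorem vecOf_coord (v : Fin d → ℝ) (j : Fin d) : vecOf v j = v j := rfl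

theorem EuclideanSpace.norm_le_norm_of_abs_le {u v : EuclideanSpace ℝ (Fin d)}
    (h : ∀ j, |u j| ≤ |v j|) : ‖u‖ ≤ ‖v‖ := by
  refine le_of_sq_le_sq ?_ (norm_nonneg _)
  rw [EuclideanSpace.real_norm_sq_eq, EuclideanSpace.real_norm_sq_eq]
  exact Finset.sum_le_sum fun j _ => sq_le_sq.mpr (h j)

theorem norm_posPart_sub_le (v z : EuclideanSpace ℝ (Fin d)) (hz : ∀ j, 0 ≤ z j) :
    ‖posPart v - z‖ ≤ ‖v - z‖ := by
  refine EuclideanSpace.norm_le_norm_of_abs_le fun j => ?_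
  simp only [PiLp.sub_apply, posPart_coord]
  have := hz j
  rcases max_cases (v j) 0 with h | h
  · rw [h.1]
  · rw [h.1, abs_of_nonpos (by linarith), abs_of_nonpos (by linarith)]; linarith

theorem norm_posPart_le (v : EuclideanSpace ℝ (Fin d)) : ‖posPart v‖ ≤ ‖v‖ := by
  simpa using norm_posPart_sub_le v 0 (fun _ => le_rfl)

theorem inner_eq_sum_mul (u v : EuclideanSpace ℝ (Fin d)) : ⟪u, v⟫ = ∑ j, u j * v j := by
  simp [PiLp.inner_apply, mul_comm]

end PosPart

/-! ### Bregman proximal steps -/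

theorem breg_three_point {d : ℕ} (ψ : EuclideanSpace ℝ (Fin d) → ℝ)
    (ψ' : EuclideanSpace ℝ (Fin d) → EuclideanSpace ℝ (Fin d))
    (x y z : EuclideanSpace ℝ (Fin d)) :
    ⟪ψ' z - ψ' x, y - z⟫ = breg ψ ψ' y x - breg ψ ψ' y z - breg ψ ψ' z x := by
  have : y - x = (y - z) + (z - x) := by abel
  simp only [breg, this, inner_sub_left, inner_add_right]
  ring

theorem breg_prox_le {d : ℕ} {X : Set (EuclideanSpace ℝ (Fin d))} (hX : Convex ℝ X)
    {ψ : EuclideanSpace ℝ (Fin d) → ℝ}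
    {ψ' : EuclideanSpace ℝ (Fin d) → EuclideanSpace ℝ (Fin d)}
    (hψ : ∀ z, HasGradientAt ψ (ψ' z) z) {r : EuclideanSpace ℝ (Fin d) → ℝ}
    (hr : ConvexOn ℝ X r) {α : ℝ} (hα : 0 < α) {a x z y : EuclideanSpace ℝ (Fin d)}
    (hz : z ∈ X) (hy : y ∈ X)
    (hmin : ∀ u ∈ X, α * ⟪z, a⟫ + α * r z + breg ψ ψ' z x
      ≤ α * ⟪u, a⟫ + α * r u + breg ψ ψ' u x) :
    α * (⟪z - y, a⟫ + (r z - r y)) ≤ breg ψ ψ' y x - breg ψ ψ' y z - breg ψ ψ' z x := by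
  rw [← breg_three_point]
  set L : ℝ := α * (⟪y - z, a⟫ + (r y - r z)) with hL
  set φ : ℝ → ℝ := fun s => s * L + breg ψ ψ' (z + s • (y - z)) x with hφ
  have hmin' : ∀ s ∈ Set.Ioo (0 : ℝ) 1, φ 0 ≤ φ s := fun s hs => by
    have hmem : z + s • (y - z) ∈ X := by
      have := hX hz hy (sub_nonneg.mpr hs.2.le) hs.1.le (by ring)
      convert this using 1
      module
    have hrs : r (z + s • (y - z)) ≤ (1 - s) * r z + s * r y := by
      have := hr.2 hz hy (sub_nonneg.mpr hs.2.le) hs.1.le (by ring)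
      have e : z + s • (y - z) = (1 - s) • z + s • y := by module
      rw [e]
      simpa using this
    have h1 := hmin _ hmem
    rw [inner_add_left, real_inner_smul_left] at h1
    have h2 := mul_le_mul_of_nonneg_left hrs hα.le
    simp only [hφ, hL, zero_mul, zero_smul, add_zero, zero_add]
    linarith
  have hder : HasDerivAt φ (L + ⟪ψ' z - ψ' x, y - z⟫) 0 := by
    have hline : HasDerivAt (fun s : ℝ => z + s • (y - z)) (y - z) 0 := by
      simpa using ((hasDerivAt_id (0 : ℝ)).smul_const (y - z)).const_add z
    have h1 : HasDerivAt (fun s : ℝ => ψ (z + s • (y - z))) ⟪ψ' z, y - z⟫ 0 := by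
      have hf : HasFDerivAt ψ (InnerProductSpace.toDual ℝ _ (ψ' z)) (z + (0 : ℝ) • (y - z)) := by
        simpa using (hψ z).hasFDerivAt
      exact (hf.comp_hasDerivAt (0 : ℝ) hline).congr_deriv (by simp)
    have h2 : HasDerivAt (fun s : ℝ => ⟪ψ' x, z + s • (y - z) - x⟫) ⟪ψ' x, y - z⟫ 0 := by
      simpa using (hasDerivAt_const (0 : ℝ) (ψ' x)).inner ℝ (hline.sub_const x)
    have h3 := ((hasDerivAt_id (0 : ℝ)).mul_const L).add ((h1.sub_const (ψ x)).sub h2)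
    exact h3.congr_deriv (by rw [inner_sub_left]; ring)
  have hge : 0 ≤ L + ⟪ψ' z - ψ' x, y - z⟫ := by
    have ht := hder.hasDerivWithinAt (s := Set.Ioi 0)
    rw [hasDerivWithinAt_iff_tendsto_slope' (by simp)] at ht
    refine ge_of_tendsto ht ?_
    filter_upwards [Ioo_mem_nhdsGT (zero_lt_one' ℝ)] with s hs
    rw [slope_def_field]
    exact div_nonneg (sub_nonneg.mpr (hmin' s hs)) (by linarith [hs.1])
  have e : ⟪z - y, a⟫ = -⟪y - z, a⟫ := by rw [← inner_neg_left, neg_sub]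
  rw [e]
  linarith

namespace Alg

variable {n m : ℕ} {p : Fin n → ℕ} (S : Alg n m p)

theorem isMixing (t : ℕ) : IsMixing S.w (S.W t) :=
  ⟨S.hWnonneg t, S.hWrow t, S.hWcol t, S.hWdiag t, S.hWpos t⟩

theorem x_mem (t : ℕ) (i : Fin n) : S.x t i ∈ S.X i := by
  cases t with
  | zero => exact S.hx0 i
  | succ t =>
    rw [S.hx _ (by omega)]
    exact S.hΦmaps _ _ _ (S.hxtilmem _ (by omega) i)

theorem norm_sub_le_diam (i : Fin n) {u v : EuclideanSpace ℝ (Fin (p i))} (hu : u ∈ S.X i)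
    (hv : v ∈ S.X i) : ‖u - v‖ ≤ S.dX := by
  classical
  have h := S.hdiam (WithLp.toLp 2 (Function.update (S.x 0) i u))
    (WithLp.toLp 2 (Function.update (S.x 0) i v)) ?_ ?_
  · refine le_trans ?_ h
    refine le_trans (le_of_eq ?_) (PiLp.norm_apply_le _ i)
    simp
  · intro j
    by_cases hj : j = i
    · subst hj; simpa using hu
    · simpa [Function.update_of_ne hj] using S.x_mem 0 j
  · intro j
    by_cases hj : j = i
    · subst hj; simpa using hv
    · simpa [Function.update_of_ne hj] using S.x_mem 0 j

theorem B1_pos : 0 < S.B1 := by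
  have := S.hF; have := S.hG; have := S.hdX
  unfold B1; positivity

theorem q_nonneg (t : ℕ) (i : Fin n) (j : Fin m) : 0 ≤ S.q t i j := by
  cases t with
  | zero => simp [S.hq0]
  | succ t => rw [S.hq _ (by omega), posPart_coord]; exact le_max_right _ _

theorem qtil_succ (t : ℕ) (i : Fin n) : S.qtil (t + 1) i = ∑ j, S.W t i j • S.q t j := by
  simpa using S.hqtil (t + 1) (by omega) i

theorem qtil_nonneg (t : ℕ) (i : Fin n) (j : Fin m) : 0 ≤ S.qtil (t + 1) i j := by
  rw [qtil_succ]
  simpa using Finset.sum_nonneg fun k _ => mul_nonneg (S.hWnonneg t i k) (S.q_nonneg t k j)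

theorem b_succ (t : ℕ) (i : Fin n) : S.b (t + 1) i =
    vecOf (fun j => ⟪S.Gg t i (S.x t i) j, S.xtil (t + 1) i - S.x t i⟫) + S.g t i (S.x t i) := by
  simpa using S.hb (t + 1) (by omega) i

theorem b_le (t : ℕ) (i : Fin n) (j : Fin m) :
    S.b (t + 1) i j ≤ S.g t i (S.xtil (t + 1) i) j := by
  have := S.hGgsub t i _ (S.x_mem t i) j _ (S.hxtilmem (t + 1) (by omega) i)
  rw [b_succ]
  simp only [PiLp.add_apply, vecOf_coord]
  linarith

theorem norm_b_le (t : ℕ) (i : Fin n) : ‖S.b (t + 1) i‖ ≤ S.G * S.dX + S.F := by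
  rw [b_succ]
  refine (norm_add_le _ _).trans (add_le_add ?_ (S.hgbound t i _ (S.x_mem t i)))
  refine (S.hGgbound t i _ (S.x_mem t i) _).trans (mul_le_mul_of_nonneg_left ?_ S.hG.le)
  exact S.norm_sub_le_diam i (S.hxtilmem (t + 1) (by omega) i) (S.x_mem t i)

theorem norm_q_succ_le (hγβ : ∀ t, 1 ≤ t → S.γ t * S.β t ≤ 1) (t : ℕ) (i : Fin n) :
    ‖S.q (t + 1) i‖ ≤
      (1 - S.γ (t + 1) * S.β (t + 1)) * ‖S.qtil (t + 1) i‖ + S.γ (t + 1) * S.F := by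
  have hγ := S.hγpos (t + 1) (by omega)
  have h1 := hγβ (t + 1) (by omega)
  have hg := S.hgbound t i _ (S.hxtilmem (t + 1) (by omega) i)
  set z := (1 - S.γ (t + 1) * S.β (t + 1)) • S.qtil (t + 1) i
    + S.γ (t + 1) • posPart (S.g t i (S.xtil (t + 1) i)) with hz
  have hle : ‖S.q (t + 1) i‖ ≤ ‖z‖ := by
    refine EuclideanSpace.norm_le_norm_of_abs_le fun j => ?_
    have hq := S.qtil_nonneg t i j
    have hb := S.b_le t i j
    have hzj : z j = (1 - S.γ (t + 1) * S.β (t + 1)) * S.qtil (t + 1) i j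
        + S.γ (t + 1) * max (S.g t i (S.xtil (t + 1) i) j) 0 := by
      simp [hz, posPart_coord]
    have hz0 : 0 ≤ z j := by
      rw [hzj]
      exact add_nonneg (mul_nonneg (by linarith) hq) (mul_nonneg hγ.le (le_max_right _ _))
    rw [abs_of_nonneg (S.q_nonneg _ _ _), abs_of_nonneg hz0, S.hq _ (by omega), posPart_coord]
    refine max_le ?_ hz0
    have := mul_le_mul_of_nonneg_left (hb.trans (le_max_left _ 0)) hγ.le
    simp only [PiLp.add_apply, PiLp.smul_apply, PiLp.sub_apply, smul_eq_mul]
    rw [hzj]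
    linarith
  refine hle.trans ((norm_add_le _ _).trans (add_le_add ?_ ?_))
  · rw [norm_smul, Real.norm_of_nonneg (by linarith)]
  · rw [norm_smul, Real.norm_of_nonneg hγ.le]
    exact mul_le_mul_of_nonneg_left ((norm_posPart_le _).trans hg) hγ.le

theorem β_mul_norm_qtil_le (hγβ : ∀ t, 1 ≤ t → S.γ t * S.β t ≤ 1) (t : ℕ) (i : Fin n) :
    S.β (t + 1) * ‖S.qtil (t + 1) i‖ ≤ S.F := by
  induction t generalizing i with
  | zero => simp [qtil_succ, S.hq0, S.hF.le]
  | succ t ih =>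
    have hβ := S.hβpos (t + 1) (by omega)
    have hγ := S.hγpos (t + 1) (by omega)
    have hq : ∀ j, S.β (t + 1) * ‖S.q (t + 1) j‖ ≤ S.F := fun j => by
      have h1 := S.norm_q_succ_le hγβ t j
      have h2 := mul_le_mul_of_nonneg_left h1 hβ.le
      have h3 := mul_le_mul_of_nonneg_left (ih j)
        (sub_nonneg.mpr (hγβ (t + 1) (by omega)))
      linarith
    calc S.β (t + 1 + 1) * ‖S.qtil (t + 1 + 1) i‖
        ≤ S.β (t + 1) * ‖S.qtil (t + 1 + 1) i‖ :=
          mul_le_mul_of_nonneg_right (S.hβanti _ _ (by omega) (by omega)) (norm_nonneg _)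
      _ ≤ S.β (t + 1) * ∑ j, S.W (t + 1) i j * ‖S.q (t + 1) j‖ := by
          rw [qtil_succ]
          refine mul_le_mul_of_nonneg_left ((norm_sum_le _ _).trans (le_of_eq ?_)) hβ.le
          refine Finset.sum_congr rfl fun j _ => ?_
          rw [norm_smul, Real.norm_of_nonneg (S.hWnonneg _ _ _)]
      _ = ∑ j, S.W (t + 1) i j * (S.β (t + 1) * ‖S.q (t + 1) j‖) := by
          rw [Finset.mul_sum]
          exact Finset.sum_congr rfl fun j _ => by ring
      _ ≤ ∑ j, S.W (t + 1) i j * S.F :=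
          Finset.sum_le_sum fun j _ => mul_le_mul_of_nonneg_left (hq j) (S.hWnonneg _ _ _)
      _ = S.F := by rw [← Finset.sum_mul, S.hWrow, one_mul]

theorem norm_b_sub_le (hγβ : ∀ t, 1 ≤ t → S.γ t * S.β t ≤ 1) (t : ℕ) (i : Fin n) :
    ‖S.b (t + 1) i - S.β (t + 1) • S.qtil (t + 1) i‖ ≤ S.B1 := by
  refine (norm_sub_le _ _).trans ?_
  rw [norm_smul, Real.norm_of_nonneg (S.hβpos (t + 1) (by omega)).le, B1]
  linarith [S.norm_b_le t i, S.β_mul_norm_qtil_le hγβ t i]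

theorem norm_q_sub_qtil_le (hγβ : ∀ t, 1 ≤ t → S.γ t * S.β t ≤ 1) (t : ℕ) (i : Fin n) :
    ‖S.q (t + 1) i - S.qtil (t + 1) i‖ ≤ S.γ (t + 1) * S.B1 := by
  have hγ := S.hγpos (t + 1) (by omega)
  rw [S.hq _ (by omega)]
  refine (norm_posPart_sub_le _ _ (S.qtil_nonneg t i)).trans ?_
  rw [add_sub_cancel_left, norm_smul, Real.norm_of_nonneg hγ.le]
  exact mul_le_mul_of_nonneg_left (S.norm_b_sub_le hγβ t i) hγ.le

theorem neg_inner_qtil_b_le (hγβ : ∀ t, 1 ≤ t → S.γ t * S.β t ≤ 1) (t : ℕ) (i : Fin n) :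
    -⟪S.qtil (t + 1) i, S.b (t + 1) i⟫ ≤
      (2 * S.γ (t + 1))⁻¹ * (‖S.qtil (t + 1) i‖ ^ 2 - ‖S.q (t + 1) i‖ ^ 2)
        - S.β (t + 1) * ‖S.qtil (t + 1) i‖ ^ 2 + S.γ (t + 1) * S.B1 ^ 2 / 2 := by
  have hγ := S.hγpos (t + 1) (by omega)
  have h1 : ‖S.q (t + 1) i‖ ^ 2 ≤ ‖S.qtil (t + 1) i
      + S.γ (t + 1) • (S.b (t + 1) i - S.β (t + 1) • S.qtil (t + 1) i)‖ ^ 2 := by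
    rw [S.hq _ (by omega)]
    exact pow_le_pow_left₀ (norm_nonneg _) (norm_posPart_le _) 2
  rw [norm_add_sq_real, norm_smul, real_inner_smul_right, inner_sub_right, real_inner_smul_right,
    real_inner_self_eq_norm_sq, Real.norm_of_nonneg hγ.le, mul_pow] at h1
  have h2 := pow_le_pow_left₀ (norm_nonneg _) (S.norm_b_sub_le hγβ t i) 2
  have h3 := mul_le_mul_of_nonneg_left h2 (sq_nonneg (S.γ (t + 1)))
  rw [inv_mul_eq_div]
  have h4 : S.γ (t + 1) * (2 * (-⟪S.qtil (t + 1) i, S.b (t + 1) i⟫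
      + S.β (t + 1) * ‖S.qtil (t + 1) i‖ ^ 2 - S.γ (t + 1) * S.B1 ^ 2 / 2))
      ≤ ‖S.qtil (t + 1) i‖ ^ 2 - ‖S.q (t + 1) i‖ ^ 2 := by linarith
  have h5 : -⟪S.qtil (t + 1) i, S.b (t + 1) i⟫
      + S.β (t + 1) * ‖S.qtil (t + 1) i‖ ^ 2 - S.γ (t + 1) * S.B1 ^ 2 / 2
      ≤ (‖S.qtil (t + 1) i‖ ^ 2 - ‖S.q (t + 1) i‖ ^ 2) / (2 * S.γ (t + 1)) := by
    rw [le_div_iff₀ (by positivity)]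
    linarith
  linarith

theorem sigma_bound_breg (i : Fin n) {z u : EuclideanSpace ℝ (Fin (p i))} (hz : z ∈ S.X i)
    (hu : u ∈ S.X i) : S.σ i / 2 * ‖z - u‖ ^ 2 ≤ breg (S.ψ i) (S.ψ' i) z u := by
  have := S.hψstrong i z hz u hu
  unfold breg
  linarith

theorem breg_nonneg (i : Fin n) {z u : EuclideanSpace ℝ (Fin (p i))} (hz : z ∈ S.X i)
    (hu : u ∈ S.X i) : 0 ≤ breg (S.ψ i) (S.ψ' i) z u := by
  have := S.hσ i
  exact le_trans (by positivity) (S.sigma_bound_breg i hz hu)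

theorem breg_le (i : Fin n) {z u : EuclideanSpace ℝ (Fin (p i))} (hz : z ∈ S.X i)
    (hu : u ∈ S.X i) : breg (S.ψ i) (S.ψ' i) z u ≤ S.K * S.dX := by
  have h := S.hbregLip i z hz u hu u hu
  have h0 : breg (S.ψ i) (S.ψ' i) u u = 0 := by simp [breg]
  rw [h0, sub_zero] at h
  exact (le_abs_self _).trans
    (h.trans (mul_le_mul_of_nonneg_left (S.norm_sub_le_diam i hz hu) S.hK.le))

theorem breg_succ_sub_le (t : ℕ) (i : Fin n) {y y' : EuclideanSpace ℝ (Fin (p i))}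
    (hy : y ∈ S.X i) (hy' : y' ∈ S.X i) :
    breg (S.ψ i) (S.ψ' i) y' (S.x (t + 1) i) - S.K * ‖y' - S.Φ (t + 1) i y‖
      ≤ breg (S.ψ i) (S.ψ' i) y (S.xtil (t + 1) i) := by
  have h1 := S.hΦcontract (t + 1) i y hy _ (S.hxtilmem (t + 1) (by omega) i)
  rw [← S.hx _ (by omega)] at h1
  have h2 := (le_abs_self _).trans (S.hbregLip i y' hy' _ (S.hΦmaps (t + 1) i y hy) _
    (S.x_mem (t + 1) i))
  linarith

theorem inner_a (t : ℕ) (i : Fin n) (v : EuclideanSpace ℝ (Fin (p i))) :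
    ⟪v, S.a (t + 1) i⟫ = ⟪S.Gf t i (S.x t i), v⟫
      + ∑ j, S.qtil (t + 1) i j * ⟪S.Gg t i (S.x t i) j, v⟫ := by
  have := S.ha (t + 1) (by omega) i
  simp only [Nat.add_sub_cancel] at this
  rw [this, real_inner_comm, inner_add_left, sum_inner]
  simp only [real_inner_smul_left]

/-- One-step comparison for a single agent. -/
theorem agent_step_le (t : ℕ) (i : Fin n) {y : EuclideanSpace ℝ (Fin (p i))} (hy : y ∈ S.X i) :
    (S.f t i (S.x t i) + S.r t i (S.x t i)) - (S.f t i y + S.r t i y) ≤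
      2 * S.G ^ 2 * S.α (t + 1) / S.σ i
        + (S.α (t + 1))⁻¹ * (breg (S.ψ i) (S.ψ' i) y (S.x t i)
          - breg (S.ψ i) (S.ψ' i) y (S.xtil (t + 1) i))
        - ⟪S.qtil (t + 1) i, S.b (t + 1) i⟫ + ⟪S.qtil (t + 1) i, S.g t i y⟫ := by
  have hα := S.hαpos (t + 1) (by omega)
  have hσ := S.hσ i
  have hx := S.x_mem t i
  have hxt := S.hxtilmem (t + 1) (by omega) i
  set x := S.x t i with hxdef
  set z := S.xtil (t + 1) i with hz
  have hprox := breg_prox_le (S.hXconvex i) (S.hψgrad i) (S.hrconvex t i) hα hxt hy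
    (a := S.a (t + 1) i) (x := x) (by simpa using S.hxtilmin (t + 1) (by omega) i)
  rw [inner_a] at hprox
  have hf := S.hGfsub t i x hx y hy
  have hr := S.hGrsub t i x hx z hxt
  have hstrong := S.sigma_bound_breg i hxt hx
  have hgf : ⟪S.Gf t i x, x - z⟫ ≤ S.G * ‖z - x‖ := by
    rw [norm_sub_rev]
    exact (real_inner_le_norm _ _).trans
      (mul_le_mul_of_nonneg_right (S.hGfbound t i x hx) (norm_nonneg _))
  have hgr : ⟪S.Gr t i x, x - z⟫ ≤ S.G * ‖z - x‖ := by
    rw [norm_sub_rev]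
    exact (real_inner_le_norm _ _).trans
      (mul_le_mul_of_nonneg_right (S.hGrbound t i x hx) (norm_nonneg _))
  have hq : ⟪S.qtil (t + 1) i, S.b (t + 1) i⟫ - ⟪S.qtil (t + 1) i, S.g t i y⟫
      ≤ ∑ j, S.qtil (t + 1) i j * ⟪S.Gg t i x j, z - y⟫ := by
    rw [inner_eq_sum_mul, inner_eq_sum_mul, ← Finset.sum_sub_distrib]
    refine Finset.sum_le_sum fun j _ => ?_
    rw [← mul_sub]
    refine mul_le_mul_of_nonneg_left ?_ (S.qtil_nonneg t i j)
    have h := S.hGgsub t i x hx j y hy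
    have e : z - y = (z - x) - (y - x) := by abel
    rw [e, inner_sub_right, b_succ]
    simp only [PiLp.add_apply, vecOf_coord]
    linarith
  have hyx : ⟪S.Gf t i x, z - y⟫ = -⟪S.Gf t i x, x - z⟫ - ⟪S.Gf t i x, y - x⟫ := by
    have e : z - y = -(x - z) - (y - x) := by abel
    rw [e, inner_sub_right, inner_neg_right]
  have hzx : ⟪S.Gr t i x, z - x⟫ = -⟪S.Gr t i x, x - z⟫ := by
    rw [← inner_neg_right, neg_sub]
  have hsq : 2 * S.G * ‖z - x‖ ≤ 2 * S.G ^ 2 * S.α (t + 1) / S.σ i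
      + (S.α (t + 1))⁻¹ * (S.σ i / 2 * ‖z - x‖ ^ 2) := by
    have e : 2 * S.G ^ 2 * S.α (t + 1) / S.σ i + (S.α (t + 1))⁻¹ * (S.σ i / 2 * ‖z - x‖ ^ 2)
        - 2 * S.G * ‖z - x‖
        = (2 * S.G * S.α (t + 1) - S.σ i * ‖z - x‖) ^ 2 / (2 * S.α (t + 1) * S.σ i) := by
      field_simp; ring
    have : 0 ≤ (2 * S.G * S.α (t + 1) - S.σ i * ‖z - x‖) ^ 2 / (2 * S.α (t + 1) * S.σ i) := by
      positivity
    linarith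
  rw [← le_inv_mul_iff₀ hα] at hprox
  have hbr := mul_le_mul_of_nonneg_left hstrong (inv_pos.mpr hα).le
  rw [hzx] at hr
  rw [hyx] at hprox
  linarith

theorem contraction_pos : 0 < 1 - S.w / (2 * (n : ℝ) ^ 2) := by
  have hn : (1 : ℝ) ≤ n := by exact_mod_cast S.hn
  have h : S.w / (2 * (n : ℝ) ^ 2) < 1 := by
    rw [div_lt_one (by positivity)]
    nlinarith [S.hw1]
  linarith

theorem tau_pos : 0 < S.tau := inv_pos.mpr (pow_pos S.contraction_pos 2)

theorem lam_pos : 0 < S.lam := Real.rpow_pos_of_pos S.contraction_pos _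

theorem lam_lt_one : S.lam < 1 := by
  have hn : (0 : ℝ) < n := by exact_mod_cast S.hn
  have hι : (0 : ℝ) < S.iota := by exact_mod_cast S.hiota
  have := S.hw0
  refine Real.rpow_lt_one S.contraction_pos.le ?_ (inv_pos.mpr hι)
  have : 0 < S.w / (2 * (n : ℝ) ^ 2) := by positivity
  linarith

/-- Deviations of the dual variables from their average. -/
def dualDev (t : ℕ) : AgentState n m := WithLp.toLp 2 fun i => S.q t i - S.qbar t

/-- Centred increments of the dual variables. -/
def dualNoise (t : ℕ) : AgentState n m := WithLp.toLp 2 fun i =>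
  (S.q t i - S.qtil t i) - (n : ℝ)⁻¹ • ∑ j, (S.q t j - S.qtil t j)

theorem mix_dualDev (t : ℕ) (i : Fin n) :
    mix (S.W t) (S.dualDev t) i = S.qtil (t + 1) i - S.qbar t := by
  simp only [mix_apply, dualDev, smul_sub, Finset.sum_sub_distrib, ← Finset.sum_smul, S.hWrow,
    one_smul, qtil_succ]

theorem mean_qtil (t : ℕ) : (n : ℝ)⁻¹ • ∑ i, S.qtil (t + 1) i = S.qbar t := by
  simp only [qtil_succ, qbar]
  rw [Finset.sum_comm]
  simp only [← Finset.sum_smul, S.hWcol, one_smul]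

theorem dualDev_succ (t : ℕ) :
    S.dualDev (t + 1) = mix (S.W t) (S.dualDev t) + S.dualNoise (t + 1) := by
  refine PiLp.ext fun i => ?_
  rw [PiLp.add_apply, mix_dualDev]
  simp only [dualDev, dualNoise, Finset.sum_sub_distrib, smul_sub, mean_qtil]
  simp only [qbar]
  abel

theorem sum_dualNoise (t : ℕ) : ∑ i, S.dualNoise t i = 0 := by
  have hn : (n : ℝ) ≠ 0 := by exact_mod_cast S.hn.ne'
  simp only [dualNoise]
  rw [Finset.sum_sub_distrib, Finset.sum_const, Finset.card_univ, Fintype.card_fin,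
    ← Nat.cast_smul_eq_nsmul ℝ, smul_smul, mul_inv_cancel₀ hn, one_smul, sub_self]

theorem norm_dualNoise_le (hγβ : ∀ t, 1 ≤ t → S.γ t * S.β t ≤ 1) (t : ℕ) :
    ‖S.dualNoise (t + 1)‖ ≤ 2 * n * S.B1 * S.γ (t + 1) := by
  have hn : (1 : ℝ) ≤ n := by exact_mod_cast S.hn
  have hγ := S.hγpos (t + 1) (by omega)
  have hB := S.B1_pos
  have hi : ∀ i, ‖S.dualNoise (t + 1) i‖ ≤ 2 * S.B1 * S.γ (t + 1) := fun i => by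
    have h1 := S.norm_q_sub_qtil_le hγβ t i
    have h2 : ‖(n : ℝ)⁻¹ • ∑ j, (S.q (t + 1) j - S.qtil (t + 1) j)‖ ≤ S.γ (t + 1) * S.B1 := by
      rw [norm_smul, Real.norm_of_nonneg (by positivity), inv_mul_le_iff₀ (by linarith)]
      refine (norm_sum_le _ _).trans
        ((Finset.sum_le_sum fun j _ => S.norm_q_sub_qtil_le hγβ t j).trans ?_)
      simp
    refine (norm_sub_le _ _).trans ?_
    linarith
  refine le_of_sq_le_sq ?_ (by positivity)
  rw [PiLp.norm_sq_eq_of_L2]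
  calc ∑ i, ‖S.dualNoise (t + 1) i‖ ^ 2
      ≤ ∑ _i : Fin n, (2 * S.B1 * S.γ (t + 1)) ^ 2 :=
        Finset.sum_le_sum fun i _ => pow_le_pow_left₀ (norm_nonneg _) (hi i) 2
    _ = n * (2 * S.B1 * S.γ (t + 1)) ^ 2 := by simp
    _ ≤ n ^ 2 * (2 * S.B1 * S.γ (t + 1)) ^ 2 := by
        refine mul_le_mul_of_nonneg_right ?_ (sq_nonneg _)
        nlinarith
    _ = (2 * n * S.B1 * S.γ (t + 1)) ^ 2 := by ring

/-- The geometric convolution of the dual stepsizes. -/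
def stepConv : ℕ → ℝ
  | 0 => 0
  | t + 1 => S.lam * stepConv t + S.γ (t + 1)

theorem stepConv_nonneg (t : ℕ) : 0 ≤ S.stepConv t := by
  induction t with
  | zero => exact le_rfl
  | succ t ih => exact add_nonneg (mul_nonneg S.lam_pos.le ih) (S.hγpos _ (by omega)).le

theorem sum_stepConv_le (T : ℕ) :
    ∑ t ∈ Finset.Icc 1 T, S.stepConv t ≤ (∑ t ∈ Finset.Icc 1 T, S.γ t) / (1 - S.lam) := by
  have h := sum_geometric_convolution_le S.lam_lt_one S.γ S.stepConv rfl (fun _ => rfl) T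
  have : 0 ≤ S.lam / (1 - S.lam) * S.stepConv T :=
    mul_nonneg (div_nonneg S.lam_pos.le (sub_nonneg.mpr S.lam_lt_one.le)) (S.stepConv_nonneg T)
  linarith

/-- Consensus error of the mixed dual variables. -/
theorem sum_norm_qtil_sub_qbar_le (hγβ : ∀ t, 1 ≤ t → S.γ t * S.β t ≤ 1) (t : ℕ) :
    ∑ i, ‖S.qtil (t + 1) i - S.qbar t‖ ≤ 2 * (n : ℝ) ^ 2 * S.B1 * S.tau * S.stepConv t := by
  have h := norm_mix_perturbed_le S.hw0 S.contraction_pos S.hiota S.isMixing S.hconn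
    S.dualDev S.dualNoise (PiLp.ext fun i => by simp [dualDev, qbar, S.hq0]) S.dualDev_succ
    S.sum_dualNoise (2 * n * S.B1) S.γ S.stepConv
    (fun t ht => by
      obtain ⟨s, rfl⟩ := Nat.exists_eq_add_of_le' ht
      exact S.norm_dualNoise_le hγβ s) rfl (fun _ => rfl) t 1
  change ‖mix (S.W t) (S.dualDev t)‖ ≤ 2 * n * S.B1 * S.tau * S.lam ^ 1 * S.stepConv t at h
  have hB := S.B1_pos
  have hτ := S.tau_pos
  have hC := S.stepConv_nonneg t
  have hle : ‖mix (S.W t) (S.dualDev t)‖ ≤ 2 * n * S.B1 * S.tau * S.stepConv t := by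
    have h2 := mul_le_mul_of_nonneg_right S.lam_lt_one.le
      (show 0 ≤ 2 * n * S.B1 * S.tau * S.stepConv t by positivity)
    linarith
  calc ∑ i, ‖S.qtil (t + 1) i - S.qbar t‖
      ≤ ∑ _i : Fin n, 2 * n * S.B1 * S.tau * S.stepConv t := by
        refine Finset.sum_le_sum fun i _ => ?_
        rw [← mix_dualDev]
        exact (PiLp.norm_apply_le _ i).trans hle
    _ = _ := by simp; ring

theorem sum_norm_sq_qtil_le (t : ℕ) :
    ∑ i, ‖S.qtil (t + 1) i‖ ^ 2 ≤ ∑ i, ‖S.q t i‖ ^ 2 := by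
  have h := pow_le_pow_left₀ (norm_nonneg _) (norm_mix_le (S.isMixing t)
    (WithLp.toLp 2 (S.q t) : AgentState n m)) 2
  rw [PiLp.norm_sq_eq_of_L2, PiLp.norm_sq_eq_of_L2] at h
  simpa only [mix_apply, ← qtil_succ] using h

theorem sum_inner_qtil_g_le (t : ℕ) (y : ∀ i, EuclideanSpace ℝ (Fin (p i)))
    (hy : ∀ i, y i ∈ S.X i) (hg : ∀ j, S.gsum t y j ≤ 0) :
    ∑ i, ⟪S.qtil (t + 1) i, S.g t i (y i)⟫ ≤ S.F * ∑ i, ‖S.qtil (t + 1) i - S.qbar t‖ := by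
  have hbar : ⟪S.qbar t, S.gsum t y⟫ ≤ 0 := by
    rw [inner_eq_sum_mul]
    refine Finset.sum_nonpos fun j _ => mul_nonpos_of_nonneg_of_nonpos ?_ (hg j)
    simp only [qbar, PiLp.smul_apply, WithLp.ofLp_sum, Finset.sum_apply, smul_eq_mul]
    exact mul_nonneg (by positivity) (Finset.sum_nonneg fun i _ => S.q_nonneg t i j)
  have hsplit : ∑ i, ⟪S.qtil (t + 1) i, S.g t i (y i)⟫
      = ∑ i, ⟪S.qtil (t + 1) i - S.qbar t, S.g t i (y i)⟫ + ⟪S.qbar t, S.gsum t y⟫ := by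
    simp only [inner_sub_left, Finset.sum_sub_distrib, gsum, inner_sum]
    ring
  rw [hsplit, Finset.mul_sum]
  have : ∑ i, ⟪S.qtil (t + 1) i - S.qbar t, S.g t i (y i)⟫
      ≤ ∑ i, S.F * ‖S.qtil (t + 1) i - S.qbar t‖ := Finset.sum_le_sum fun i _ => by
    rw [mul_comm]
    exact (real_inner_le_norm _ _).trans
      (mul_le_mul_of_nonneg_left (S.hgbound t i _ (hy i)) (norm_nonneg _))
  linarith

theorem sigmin_pos : 0 < S.sigmin := by
  unfold sigmin
  rw [Finset.lt_inf'_iff]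
  exact fun i _ => S.hσ i

theorem sigmin_le (i : Fin n) : S.sigmin ≤ S.σ i := Finset.inf'_le _ (Finset.mem_univ i)

/-- One-step comparison of the global objective with a feasible point. -/
theorem fsum_step_le (hγβ : ∀ t, 1 ≤ t → S.γ t * S.β t ≤ 1) (t : ℕ)
    (y : ∀ i, EuclideanSpace ℝ (Fin (p i))) (hy : ∀ i, y i ∈ S.X i)
    (hg : ∀ j, S.gsum t y j ≤ 0) :
    S.fsum t (S.x t) - S.fsum t y ≤
      2 * n * S.G ^ 2 / S.sigmin * S.α (t + 1)
        + (S.α (t + 1))⁻¹ * (∑ i, breg (S.ψ i) (S.ψ' i) (y i) (S.x t i)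
          - ∑ i, breg (S.ψ i) (S.ψ' i) (y i) (S.xtil (t + 1) i))
        + ((2 * S.γ (t + 1))⁻¹ * (∑ i, ‖S.qtil (t + 1) i‖ ^ 2 - ∑ i, ‖S.q (t + 1) i‖ ^ 2)
          - S.β (t + 1) * ∑ i, ‖S.qtil (t + 1) i‖ ^ 2)
        + n * S.B1 ^ 2 / 2 * S.γ (t + 1)
        + 2 * (n : ℝ) ^ 2 * S.tau * S.B1 * S.F * S.stepConv t := by
  have hα := S.hαpos (t + 1) (by omega)
  have hi : ∀ i ∈ Finset.univ,
      (S.f t i (S.x t i) + S.r t i (S.x t i)) - (S.f t i (y i) + S.r t i (y i)) ≤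
      2 * S.G ^ 2 / S.sigmin * S.α (t + 1)
        + (S.α (t + 1))⁻¹ * (breg (S.ψ i) (S.ψ' i) (y i) (S.x t i)
          - breg (S.ψ i) (S.ψ' i) (y i) (S.xtil (t + 1) i))
        + ((2 * S.γ (t + 1))⁻¹ * (‖S.qtil (t + 1) i‖ ^ 2 - ‖S.q (t + 1) i‖ ^ 2)
          - S.β (t + 1) * ‖S.qtil (t + 1) i‖ ^ 2)
        + S.γ (t + 1) * S.B1 ^ 2 / 2 + ⟪S.qtil (t + 1) i, S.g t i (y i)⟫ := fun i _ => by
    have h1 := S.agent_step_le t i (hy i)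
    have h2 := S.neg_inner_qtil_b_le hγβ t i
    have h3 : 2 * S.G ^ 2 * S.α (t + 1) / S.σ i ≤ 2 * S.G ^ 2 / S.sigmin * S.α (t + 1) := by
      rw [div_mul_eq_mul_div]
      exact div_le_div_of_nonneg_left (by positivity) S.sigmin_pos (S.sigmin_le i)
    linarith
  have hsum := Finset.sum_le_sum hi
  have hcons := S.sum_inner_qtil_g_le t y hy hg
  have hdev := mul_le_mul_of_nonneg_left (S.sum_norm_qtil_sub_qbar_le hγβ t) S.hF.le
  simp only [Finset.sum_add_distrib, Finset.sum_sub_distrib, ← Finset.mul_sum, Finset.sum_const,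
    Finset.card_univ, Fintype.card_fin, nsmul_eq_mul] at hsum
  simp only [fsum, Finset.sum_add_distrib]
  have e : 2 * n * S.G ^ 2 / S.sigmin * S.α (t + 1)
      = n * (2 * S.G ^ 2 / S.sigmin * S.α (t + 1)) := by ring
  rw [e]
  linarith

theorem sum_dual_energy_le
    (hγβ : ∀ t, 1 ≤ t → (2 * S.γ (t + 1))⁻¹ - (2 * S.γ t)⁻¹ ≤ S.β (t + 1)) (T : ℕ) :
    ∑ t ∈ Finset.Icc 1 T,
      ((2 * S.γ (t + 1))⁻¹ * (∑ i, ‖S.qtil (t + 1) i‖ ^ 2 - ∑ i, ‖S.q (t + 1) i‖ ^ 2)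
        - S.β (t + 1) * ∑ i, ‖S.qtil (t + 1) i‖ ^ 2)
      ≤ -((2 * S.γ (T + 1))⁻¹ * ∑ i, ‖S.q (T + 1) i‖ ^ 2) := by
  induction T with
  | zero =>
    have hq1 : ∀ i, S.q 1 i = 0 := fun i => by
      have hqt : S.qtil 1 i = 0 := by simpa [S.hq0] using S.qtil_succ 0 i
      ext j
      have hb := S.b_le 0 i j
      rw [S.hg0] at hb
      rw [S.hq 1 le_rfl, posPart_coord, hqt]
      simpa using mul_nonpos_of_nonneg_of_nonpos (S.hγpos 1 le_rfl).le hb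
    simp [hq1]
  | succ T ih =>
    rw [Finset.sum_Icc_succ_top (by omega)]
    have hγ := S.hγpos (T + 1) (by omega)
    have h1 := mul_le_mul_of_nonneg_left (S.sum_norm_sq_qtil_le (T + 1))
      (show 0 ≤ (2 * S.γ (T + 1))⁻¹ by positivity)
    have h2 := mul_le_mul_of_nonneg_right (hγβ (T + 1) (by omega))
      (show 0 ≤ ∑ i, ‖S.qtil (T + 1 + 1) i‖ ^ 2 by positivity)
    linarith

end Alg

theorem statement_8 {n m : ℕ} {p : Fin n → ℕ} (S : Alg n m p)
    (c κ : ℝ) (hc0 : 0 < c) (hc1 : c < 1) (hκ0 : 0 < κ) (hκ1 : κ < 1)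
    (hα : ∀ t : ℕ, 1 ≤ t → S.α t = ((t : ℝ) ^ c)⁻¹)
    (hβ : ∀ t : ℕ, 1 ≤ t → S.β t = ((t : ℝ) ^ κ)⁻¹)
    (hγ : ∀ t : ℕ, 1 ≤ t → S.γ t = ((t : ℝ) ^ (1 - κ))⁻¹)
    (T : ℕ) (hT : 1 ≤ T)
    (xs : ℕ → ∀ i, EuclideanSpace ℝ (Fin (p i)))
    (hxsfeas : S.Feasible T xs)
    (hxsopt : ∀ y, S.Feasible T y →
      ∑ t ∈ Finset.Icc 1 T, S.fsum t (xs t) ≤ ∑ t ∈ Finset.Icc 1 T, S.fsum t (y t)) :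
    S.reg T xs ≤
      (S.C11 / κ + S.C12 / (1 - c) + 2 * (n : ℝ) * S.dX * S.K)
        * (T : ℝ) ^ max (max (1 - c) c) κ
      + 2 * S.K * (T : ℝ) ^ c * S.VPhi T xs := by
  have htpos : ∀ t : ℕ, 1 ≤ t → (0 : ℝ) < t := fun t ht => by exact_mod_cast ht
  have hγβ : ∀ t, 1 ≤ t → S.γ t * S.β t ≤ 1 := fun t ht => by
    have h := htpos t ht
    rw [hγ t ht, hβ t ht, ← mul_inv, ← Real.rpow_add h]
    simpa using inv_le_one_of_one_le₀ (show (1 : ℝ) ≤ t by exact_mod_cast ht)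
  have hγβ' : ∀ t, 1 ≤ t → (2 * S.γ (t + 1))⁻¹ - (2 * S.γ t)⁻¹ ≤ S.β (t + 1) := fun t ht => by
    have h := rpow_succ_sub_le hκ0 (htpos t ht)
    have hβ0 := S.hβpos (t + 1) (by omega)
    rw [hγ (t + 1) (by omega), hγ t ht]
    rw [hβ (t + 1) (by omega)] at hβ0 ⊢
    push_cast at hβ0 ⊢
    simp only [mul_inv, inv_inv]
    linarith
  have hT0 := htpos T hT
  have hT1 : (1 : ℝ) ≤ T := by exact_mod_cast hT
  have hσ0 := S.sigmin_pos
  have hτ0 := S.tau_pos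
  have hB0 := S.B1_pos
  have hF0 := S.hF
  have hK0 := S.hK
  have hdX0 := S.hdX
  have hn0 : (0 : ℝ) < n := by exact_mod_cast S.hn
  have hlam := sub_pos.mpr S.lam_lt_one
  have hsumγ : ∑ t ∈ Finset.Icc 1 T, S.γ t ≤ (T : ℝ) ^ κ / κ := by
    rw [Finset.sum_congr rfl fun t ht => hγ t (Finset.mem_Icc.mp ht).1]
    exact sum_inv_rpow_le hκ0 hκ1 T
  have hsumα : ∑ t ∈ Finset.Icc 1 T, S.α t ≤ (T : ℝ) ^ (1 - c) / (1 - c) := by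
    rw [Finset.sum_congr rfl fun t ht => hα t (Finset.mem_Icc.mp ht).1]
    simpa using sum_inv_rpow_le (sub_pos.mpr hc1) (by linarith : 1 - c < 1) T
  have hγshift : ∑ t ∈ Finset.Icc 1 T, S.γ (t + 1) ≤ ∑ t ∈ Finset.Icc 1 T, S.γ t :=
    Finset.sum_le_sum fun t ht => S.hγanti _ _ (Finset.mem_Icc.mp ht).1 t.le_succ
  have hαshift : ∑ t ∈ Finset.Icc 1 T, S.α (t + 1) ≤ ∑ t ∈ Finset.Icc 1 T, S.α t :=
    Finset.sum_le_sum fun t ht => S.hαanti _ _ (Finset.mem_Icc.mp ht).1 t.le_succ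
  have hV0 : 0 ≤ S.VPhi T xs :=
    Finset.sum_nonneg fun _ _ => Finset.sum_nonneg fun _ _ => norm_nonneg _
  have hmem : ∀ t, 1 ≤ t → t ≤ T → ∀ i, xs t i ∈ S.X i := fun t h1 h2 =>
    (hxsfeas t (Finset.mem_Icc.mpr ⟨h1, h2⟩)).1
  have hbregman : ∑ t ∈ Finset.Icc 1 T, (S.α (t + 1))⁻¹ *
      (∑ i, breg (S.ψ i) (S.ψ' i) (xs t i) (S.x t i)
        - ∑ i, breg (S.ψ i) (S.ψ' i) (xs t i) (S.xtil (t + 1) i))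
      ≤ 2 * n * S.dX * S.K * (T : ℝ) ^ c + S.K * (T : ℝ) ^ c * S.VPhi T xs := by
    obtain ⟨N, rfl⟩ := Nat.exists_eq_add_of_le' hT
    have h := sum_weighted_drift_le (fun t => (t : ℝ) ^ c)
      (fun t => ∑ i, breg (S.ψ i) (S.ψ' i) (xs t i) (S.x t i))
      (fun t => ∑ i, breg (S.ψ i) (S.ψ' i) (xs t i) (S.xtil (t + 1) i))
      (fun t => ∑ i, ‖xs (t + 1) i - S.Φ (t + 1) i (xs t i)‖) (n * (S.K * S.dX)) S.K
      (fun t => Real.rpow_nonneg t.cast_nonneg c)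
      (fun a b hab => Real.rpow_le_rpow a.cast_nonneg (by exact_mod_cast hab) hc0.le)
      hK0.le (fun t => Finset.sum_nonneg fun _ _ => norm_nonneg _) N
      (fun t h1 h2 => by
        refine (Finset.sum_le_sum fun i _ =>
          S.breg_le i (hmem t h1 h2 i) (S.x_mem t i)).trans (le_of_eq ?_)
        simp)
      (Finset.sum_nonneg fun i _ => S.breg_nonneg i (hmem (N + 1) hT le_rfl i)
        (S.hxtilmem _ (by omega) i))
      (fun t h1 h2 => by
        rw [Finset.mul_sum, ← Finset.sum_sub_distrib]
        exact Finset.sum_le_sum fun i _ => S.breg_succ_sub_le t i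
          (hmem t h1 (by omega) i) (hmem (t + 1) (by omega) (by omega) i))
    have hpow : ((N + 2 : ℕ) : ℝ) ^ c ≤ 2 * ((N + 1 : ℕ) : ℝ) ^ c := by
      calc ((N + 2 : ℕ) : ℝ) ^ c ≤ (2 * ((N + 1 : ℕ) : ℝ)) ^ c := by
            refine Real.rpow_le_rpow (by positivity) ?_ hc0.le
            push_cast
            linarith [N.cast_nonneg (α := ℝ)]
        _ = 2 ^ c * ((N + 1 : ℕ) : ℝ) ^ c := Real.mul_rpow (by norm_num) (by positivity)
        _ ≤ 2 * ((N + 1 : ℕ) : ℝ) ^ c := by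
            refine mul_le_mul_of_nonneg_right ?_ (by positivity)
            simpa using Real.rpow_le_rpow_of_exponent_le (one_le_two (α := ℝ)) hc1.le
    have hpow' := mul_le_mul_of_nonneg_right hpow
      (show 0 ≤ n * (S.K * S.dX) by positivity)
    have hα' : ∀ t ∈ Finset.Icc 1 (N + 1), (S.α (t + 1))⁻¹ *
        (∑ i, breg (S.ψ i) (S.ψ' i) (xs t i) (S.x t i)
          - ∑ i, breg (S.ψ i) (S.ψ' i) (xs t i) (S.xtil (t + 1) i))
        = ((t + 1 : ℕ) : ℝ) ^ c *
        (∑ i, breg (S.ψ i) (S.ψ' i) (xs t i) (S.x t i)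
          - ∑ i, breg (S.ψ i) (S.ψ' i) (xs t i) (S.xtil (t + 1) i)) := fun t _ => by
      rw [hα (t + 1) (by omega), inv_inv]
    rw [Finset.sum_congr rfl hα']
    simp only [Alg.VPhi, Nat.add_sub_cancel]
    linarith
  have hstep : ∀ t ∈ Finset.Icc 1 T, S.fsum t (S.x t) - S.fsum t (xs t) ≤ _ := fun t ht =>
    S.fsum_step_le hγβ t (xs t) (hxsfeas t ht).1 (hxsfeas t ht).2
  have hsum := Finset.sum_le_sum hstep
  rw [Finset.sum_sub_distrib] at hsum
  simp only [Finset.sum_add_distrib, ← Finset.mul_sum] at hsum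
  have hdual := S.sum_dual_energy_le hγβ' T
  have hdual0 : 0 ≤ (2 * S.γ (T + 1))⁻¹ * ∑ i, ‖S.q (T + 1) i‖ ^ 2 := by
    have := S.hγpos (T + 1) (by omega)
    positivity
  have hA := mul_le_mul_of_nonneg_left (hαshift.trans hsumα)
    (show 0 ≤ 2 * n * S.G ^ 2 / S.sigmin by positivity)
  have hG := mul_le_mul_of_nonneg_left (hγshift.trans hsumγ)
    (show 0 ≤ n * S.B1 ^ 2 / 2 by positivity)
  have hC := mul_le_mul_of_nonneg_left ((S.sum_stepConv_le T).trans
    (div_le_div_of_nonneg_right hsumγ hlam.le))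
    (show 0 ≤ 2 * (n : ℝ) ^ 2 * S.tau * S.B1 * S.F by positivity)
  set E := max (max (1 - c) c) κ with hE
  have p1 : (T : ℝ) ^ (1 - c) ≤ (T : ℝ) ^ E :=
    Real.rpow_le_rpow_of_exponent_le hT1 ((le_max_left _ _).trans (le_max_left _ _))
  have p2 : (T : ℝ) ^ c ≤ (T : ℝ) ^ E :=
    Real.rpow_le_rpow_of_exponent_le hT1 ((le_max_right _ _).trans (le_max_left _ _))
  have p3 : (T : ℝ) ^ κ ≤ (T : ℝ) ^ E :=
    Real.rpow_le_rpow_of_exponent_le hT1 (le_max_right _ _)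
  have hc1' : 0 < 1 - c := sub_pos.mpr hc1
  have f1 : 2 * n * S.G ^ 2 / S.sigmin * ((T : ℝ) ^ (1 - c) / (1 - c))
      ≤ S.C12 / (1 - c) * (T : ℝ) ^ E := by
    calc _ = 2 * n * S.G ^ 2 / S.sigmin / (1 - c) * (T : ℝ) ^ (1 - c) := by ring
      _ ≤ S.C12 / (1 - c) * (T : ℝ) ^ E := by
        unfold Alg.C12
        gcongr
        norm_num
  have f2 : n * S.B1 ^ 2 / 2 * ((T : ℝ) ^ κ / κ)
      + 2 * (n : ℝ) ^ 2 * S.tau * S.B1 * S.F * ((T : ℝ) ^ κ / κ / (1 - S.lam))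
      ≤ S.C11 / κ * (T : ℝ) ^ E := by
    calc _ = (2 * (n : ℝ) ^ 2 * S.tau * S.B1 * S.F / (1 - S.lam) + n * S.B1 ^ 2 / 2) / κ
          * (T : ℝ) ^ κ := by ring
      _ ≤ S.C11 / κ * (T : ℝ) ^ E := by
        unfold Alg.C11
        gcongr
        norm_num
  have f3 : 2 * n * S.dX * S.K * (T : ℝ) ^ c ≤ 2 * n * S.dX * S.K * (T : ℝ) ^ E := by
    gcongr
  have f4 : 0 ≤ S.K * (T : ℝ) ^ c * S.VPhi T xs := by positivity
  unfold Alg.reg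
  linarith

end
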